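/- Let T : ℂ[z₁,…,zₙ] → ℂ[z₁,…,zₙ] be a linear operator. Then T preserves stability (i.e., for every stable f the polynomial T(f) is stable or identically zero) if and only if either (a) T has range of dimension at most one and is of the form T(f) = α(f)·P, where α is a linear functional on ℂ[z₁,…,zₙ] and P is a stable polynomial, or (b) the transcendental symbol Ḡ_T(z,w) = Σ_{α ∈ ℕⁿ} (−1)^{|α|} T(z^α) w^α/α! converges on all of ℂ^{2n} to an entire function belonging to the complex Laguerre–Pólya class in 2n variables, i.e., an entire function that is the limit, uniformly on compact subsets of ℂ^{2n}, of stable polynomials in 2n variables. -/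

import Mathlib

open MvPolynomial

/-- A complex polynomial is *stable* if it is non-vanishing whenever all
variables lie in the open upper half-plane. -/
def IsStable {σ : Type*} (f : MvPolynomial σ ℂ) : Prop :=
  ∀ z : σ → ℂ, (∀ i, 0 < (z i).im) → MvPolynomial.eval z f ≠ 0

/-- The general term `(-1)^{|α|} T(z^α)(z) · w^α / α!` of the transcendental
symbol `Ḡ_T(z,w) = ∑_{α ∈ ℕⁿ} (-1)^{|α|} T(z^α) w^α/α!`, evaluated at a point
`zw ∈ ℂ^{2n}` (the `z`-coordinates indexed by `Sum.inl`, the `w`-coordinates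
by `Sum.inr`). -/
noncomputable def transSymbolTerm {n : ℕ}
    (T : MvPolynomial (Fin n) ℂ →ₗ[ℂ] MvPolynomial (Fin n) ℂ)
    (α : Fin n →₀ ℕ) (zw : Fin n ⊕ Fin n → ℂ) : ℂ :=
  ((-1 : ℂ) ^ (α.sum fun _ k => k) / (α.prod fun _ k => (k.factorial : ℂ))) *
    MvPolynomial.eval (zw ∘ Sum.inl) (T (monomial α 1)) *
      ∏ i, zw (Sum.inr i) ^ α i

/-- The restriction `t ↦ p (z + t v)` of a polynomial to a complex line. -/
noncomputable def lineRestrict {σ : Type*} (z v : σ → ℂ) :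
    MvPolynomial σ ℂ →ₐ[ℂ] Polynomial ℂ :=
  aeval fun j => Polynomial.C (z j) + Polynomial.C (v j) * Polynomial.X

lemma eval_lineRestrict {σ : Type*} (z v : σ → ℂ) (p : MvPolynomial σ ℂ) (t : ℂ) :
    (lineRestrict z v p).eval t = eval (fun j => z j + v j * t) p := by
  induction p using MvPolynomial.induction_on with
  | C a => simp [lineRestrict]
  | add p q hp hq => simp [hp, hq]
  | mul_X p i hp => rw [map_mul, Polynomial.eval_mul, hp]; simp [lineRestrict]

lemma derivative_lineRestrict {σ : Type*} [DecidableEq σ] (z : σ → ℂ) (i : σ)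
    (p : MvPolynomial σ ℂ) :
    Polynomial.derivative (lineRestrict z (Pi.single i 1) p) =
      lineRestrict z (Pi.single i 1) (pderiv i p) := by
  induction p using MvPolynomial.induction_on with
  | C a => simp [lineRestrict]
  | add p q hp hq => simp [hp, hq]
  | mul_X p j hp =>
    rw [map_mul, Polynomial.derivative_mul, hp, Derivation.leibniz, map_add, smul_eq_mul,
      smul_eq_mul, map_mul, map_mul, pderiv_X]
    by_cases h : j = i
    · subst h; simp [lineRestrict]; ring
    · simp [lineRestrict, h]; ring

lemma natDegree_lineRestrict_le {σ : Type*} [DecidableEq σ] (z : σ → ℂ) (i : σ)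
    (p : MvPolynomial σ ℂ) :
    (lineRestrict z (Pi.single i 1) p).natDegree ≤ degreeOf i p := by
  rw [lineRestrict, aeval_def, eval₂_eq]
  refine Polynomial.natDegree_sum_le_of_forall_le _ _ fun m hm => ?_
  refine (Polynomial.natDegree_C_mul_le _ _).trans ?_
  refine (Polynomial.natDegree_prod_le _ _).trans ?_
  refine (Finset.sum_le_sum (g := fun j => if j = i then m j else 0) fun j _ => ?_).trans ?_
  · refine Polynomial.natDegree_pow_le.trans ?_
    by_cases h : j = i
    · subst h
      simp
    · simp [h]
  · rw [Finset.sum_ite_eq']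
    split_ifs
    · exact monomial_le_degreeOf i hm
    · exact Nat.zero_le _

/-- Hurwitz's theorem in one variable, for polynomials. -/
lemma eval_zero_ne_zero_of_tendstoUniformlyOn (p : Polynomial ℂ) (hp : p ≠ 0)
    (q : ℕ → Polynomial ℂ) (r : ℝ) (hr : 0 < r)
    (hq : ∀ k, ∀ t : ℂ, ‖t‖ ≤ r → (q k).eval t ≠ 0)
    (hlim : TendstoUniformlyOn (fun k t => (q k).eval t) (fun t => p.eval t) Filter.atTop
      (Metric.closedBall 0 r)) : p.eval 0 ≠ 0 := by
  intro h0
  obtain ⟨s, hs0, hsr, hs⟩ : ∃ s : ℝ, 0 < s ∧ s ≤ r ∧ ∀ t : ℂ, ‖t‖ = s → p.eval t ≠ 0 := by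
    have hfin : {t : ℂ | p.eval t = 0}.Finite := by
      simpa [Polynomial.IsRoot] using Polynomial.finite_setOfPred_isRoot hp
    have hfin' : ((fun t : ℂ => ‖t‖) '' {t : ℂ | p.eval t = 0}).Finite := hfin.image _
    obtain ⟨s, ⟨hs1, hs2⟩, hs3⟩ := ((Set.Ioc_infinite hr).sdiff hfin').nonempty
    exact ⟨s, hs1, hs2, fun t ht h => hs3 ⟨t, h, ht⟩⟩
  have hcomp : IsCompact (Metric.sphere (0 : ℂ) s) := isCompact_sphere _ _
  obtain ⟨t₀, ht₀, hmin⟩ := hcomp.exists_isMinOn (NormedSpace.sphere_nonempty.2 hs0.le)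
    (f := fun t => ‖p.eval t‖) (by fun_prop)
  set δ := ‖p.eval t₀‖ with hδ
  have hδ0 : 0 < δ := norm_pos_iff.2 (hs t₀ (by simpa using ht₀))
  obtain ⟨k, hk⟩ := (Metric.tendstoUniformlyOn_iff.1 hlim (δ / 2) (half_pos hδ0)).exists
  have hsphere : ∀ t : ℂ, ‖t‖ = s → δ / 2 ≤ ‖(q k).eval t‖ := by
    intro t ht
    have h1 := hk t (by simp [ht, hsr])
    have h2 : δ ≤ ‖p.eval t‖ := hmin (by simp [ht])
    rw [dist_eq_norm] at h1
    have := norm_sub_norm_le (p.eval t) ((q k).eval t)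
    linarith
  have hcl : closure (Metric.ball (0 : ℂ) s) = Metric.closedBall 0 s := closure_ball _ hs0.ne'
  have hd : DiffContOnCl ℂ (fun t => ((q k).eval t)⁻¹) (Metric.ball 0 s) := by
    refine DiffContOnCl.inv (q k).differentiable.diffContOnCl fun t ht => hq k t ?_
    rw [hcl] at ht
    exact (by simpa using ht : ‖t‖ ≤ s).trans hsr
  have hmax := Complex.norm_le_of_forall_mem_frontier_norm_le Metric.isBounded_ball hd
    (C := (δ / 2)⁻¹) (fun t ht => by
      rw [frontier_ball _ hs0.ne'] at ht
      rw [norm_inv]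
      exact inv_anti₀ (half_pos hδ0) (hsphere t (by simpa using ht)))
    (z := 0) (subset_closure (by simpa using hs0))
  rw [norm_inv] at hmax
  have h3 : δ / 2 ≤ ‖(q k).eval 0‖ :=
    (inv_le_inv₀ (norm_pos_iff.2 (hq k 0 (by simpa using hr.le))) (half_pos hδ0)).1 hmax
  have h4 := hk 0 (by simpa using hr.le)
  rw [h0, dist_zero_left] at h4
  linarith

lemma exists_upperHalf_eval_ne_zero {σ : Type*} (p : MvPolynomial σ ℂ) (hp : p ≠ 0) :
    ∃ z : σ → ℂ, (∀ i, 0 < (z i).im) ∧ eval z p ≠ 0 := by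
  by_contra! h
  refine hp (funext_set (fun _ => {w : ℂ | 0 < w.im}) (fun _ => ?_) fun x hx => ?_)
  · refine Set.infinite_of_injective_forall_mem (f := fun k : ℕ => ((k : ℂ) + Complex.I)) ?_ ?_
    · intro a b hab
      simpa using hab
    · intro k; simp
  · rw [map_zero]
    exact h x fun i => hx i trivial

/-- Hurwitz's theorem for stable polynomials. -/
lemma isStable_or_eq_zero_of_tendstoUniformlyOn {σ : Type*} [Finite σ]
    (h : ℕ → MvPolynomial σ ℂ) (p : MvPolynomial σ ℂ) (hs : ∀ k, IsStable (h k) ∨ h k = 0)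
    (hlim : ∀ K : Set (σ → ℂ), IsCompact K →
      TendstoUniformlyOn (fun k z => eval z (h k)) (fun z => eval z p) Filter.atTop K) :
    IsStable p ∨ p = 0 := by
  by_contra! ⟨hns, hp⟩
  obtain ⟨z₁, hz₁, hpz₁⟩ := exists_upperHalf_eval_ne_zero p hp
  simp only [IsStable, not_forall, not_not] at hns
  obtain ⟨z₀, hz₀, hpz₀⟩ := hns
  have hev : ∀ᶠ k in Filter.atTop, h k ≠ 0 := by
    have := ((hlim {z₁} isCompact_singleton).tendsto_at rfl).eventually_ne hpz₁
    filter_upwards [this] with k hk h0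
    simp [h0] at hk
  obtain ⟨k₀, hk₀⟩ := Filter.eventually_atTop.1 hev
  have hst : ∀ k, IsStable (h (k + k₀)) := fun k =>
    (hs _).resolve_right (hk₀ _ (Nat.le_add_left _ _))
  have hnear : ∀ᶠ t : ℂ in nhds 0, ∀ i, 0 < (z₀ i + (z₁ i - z₀ i) * t).im := by
    rw [Filter.eventually_all]
    intro i
    have : ContinuousAt (fun t : ℂ => (z₀ i + (z₁ i - z₀ i) * t).im) 0 := by fun_prop
    refine this.eventually (lt_mem_nhds ?_)
    simpa using hz₀ i
  obtain ⟨r, hr, hr'⟩ := Metric.nhds_basis_closedBall.eventually_iff.1 hnear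
  have hline : Continuous fun t : ℂ => fun i => z₀ i + (z₁ i - z₀ i) * t := by fun_prop
  refine eval_zero_ne_zero_of_tendstoUniformlyOn (lineRestrict z₀ (fun i => z₁ i - z₀ i) p) ?_
    (fun k => lineRestrict z₀ (fun i => z₁ i - z₀ i) (h (k + k₀))) r hr ?_ ?_ ?_
  · intro h0
    have := eval_lineRestrict z₀ (fun i => z₁ i - z₀ i) p 1
    rw [h0] at this
    simp at this
    exact hpz₁ this.symm
  · intro k t ht
    rw [eval_lineRestrict]
    exact hst k _ (hr' (by simpa using ht))
  · have h1 := (hlim _ ((isCompact_closedBall (0 : ℂ) r).image hline))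
    simp only [eval_lineRestrict]
    rw [Metric.tendstoUniformlyOn_iff] at h1 ⊢
    intro ε hε
    have h2 := (Filter.tendsto_add_atTop_nat k₀).eventually (h1 ε hε)
    filter_upwards [h2] with k hk t ht
    exact hk _ ⟨t, ht, rfl⟩
  · rw [eval_lineRestrict]
    simpa using hpz₀

lemma mul_normSq_multiset_sum_le (y : ℝ) (hy : 0 ≤ y) (s : Multiset ℂ)
    (hs : ∀ u ∈ s, y * Complex.normSq u ≤ -u.im) :
    y * Complex.normSq s.sum ≤ s.card * (-s.sum.im) := by
  induction s using Multiset.induction_on with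
  | empty => simp
  | cons a s ih =>
    have h1 := hs a (Multiset.mem_cons_self a s)
    have h2 := ih fun u hu => hs u (Multiset.mem_cons_of_mem hu)
    rw [Multiset.sum_cons, Multiset.card_cons]
    set b := s.sum
    rcases Nat.eq_zero_or_pos s.card with h0 | hpos
    · have : b = 0 := by simp [b, Multiset.card_eq_zero.1 h0]
      rw [h0, this]
      simpa using h1
    · have hk : (0 : ℝ) < s.card := Nat.cast_pos.2 hpos
      set k : ℝ := (s.card : ℝ)
      have h3 : k * Complex.normSq (a + b) ≤
          (k + 1) * (Complex.normSq b + k * Complex.normSq a) := by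
        simp only [Complex.normSq_apply, Complex.add_re, Complex.add_im]
        nlinarith [sq_nonneg (k * a.re - b.re), sq_nonneg (k * a.im - b.im)]
      have h4 := mul_le_mul_of_nonneg_left h3 hy
      have h5 : y * Complex.normSq b + k * (y * Complex.normSq a) ≤ k * (-b.im) + k * (-a.im) :=
        add_le_add h2 (mul_le_mul_of_nonneg_left h1 hk.le)
      have h6 : k * (y * Complex.normSq (a + b)) ≤ k * ((k + 1) * (-(a.im + b.im))) := by
        have := mul_le_mul_of_nonneg_left h5 (by positivity : 0 ≤ k + 1)
        nlinarith
      push_cast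
      rw [Complex.add_im]
      exact le_of_mul_le_mul_left h6 hk

/-- The logarithmic derivative of a polynomial whose roots avoid a half-plane lies in a dilated
disc. -/
lemma mul_normSq_logDeriv_le (p : Polynomial ℂ) (y : ℝ) (hy : 0 < y)
    (hp : ∀ t : ℂ, -y < t.im → p.eval t ≠ 0) (d : ℕ) (hd : p.natDegree ≤ d) :
    y * Complex.normSq (p.derivative.eval 0 / p.eval 0) ≤
      d * (-(p.derivative.eval 0 / p.eval 0).im) := by
  have h0 : p.eval 0 ≠ 0 := hp 0 (by simpa using hy)
  have hp0 : p ≠ 0 := by rintro rfl; simp at h0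
  rw [(IsAlgClosed.splits p).eval_derivative_div_eval_of_ne_zero h0]
  have key := mul_normSq_multiset_sum_le y hy.le (p.roots.map fun z => 1 / (0 - z)) ?_
  · refine key.trans ?_
    rw [Multiset.card_map]
    have hnonneg : 0 ≤ ((p.roots.map fun z => 1 / (0 - z)).card : ℝ) *
      (-(p.roots.map fun z => 1 / (0 - z)).sum.im) :=
        (mul_nonneg hy.le (Complex.normSq_nonneg _)).trans key
    rw [Multiset.card_map] at hnonneg
    rcases Nat.eq_zero_or_pos p.roots.card with hc | hc
    · simp [Multiset.card_eq_zero.1 hc]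
    · have : 0 ≤ -(p.roots.map fun z => 1 / (0 - z)).sum.im :=
        nonneg_of_mul_nonneg_right hnonneg (Nat.cast_pos.2 hc)
      refine mul_le_mul_of_nonneg_right ?_ this
      exact_mod_cast (Polynomial.card_roots' p).trans hd
  · intro u hu
    obtain ⟨z, hz, rfl⟩ := Multiset.mem_map.1 hu
    have hz' : p.eval z = 0 := (Polynomial.mem_roots hp0).1 hz
    have him : z.im ≤ -y := by
      by_contra! h
      exact hp z h hz'
    have hz0 : 0 < Complex.normSq z := Complex.normSq_pos.2 fun h => by simp [h] at him; linarith
    rw [one_div, zero_sub, Complex.normSq_inv, Complex.normSq_neg, Complex.inv_im,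
      Complex.normSq_neg, Complex.neg_im, ← div_eq_mul_inv, ← neg_div]
    gcongr
    linarith

lemma logDeriv_bound_of_isStable {σ : Type*} (p : MvPolynomial σ ℂ) (hp : IsStable p) (i : σ)
    (z : σ → ℂ) (hz : ∀ j, 0 < (z j).im) (d : ℕ) (hd : degreeOf i p ≤ d) :
    (z i).im * Complex.normSq (eval z (pderiv i p) / eval z p) ≤
      d * (-(eval z (pderiv i p) / eval z p).im) := by
  classical
  have h := mul_normSq_logDeriv_le (lineRestrict z (Pi.single i 1) p) (z i).im (hz i) ?_ d
    ((natDegree_lineRestrict_le z i p).trans hd)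
  · rw [derivative_lineRestrict, eval_lineRestrict, eval_lineRestrict] at h
    simpa using h
  · intro t ht
    rw [eval_lineRestrict]
    refine hp _ fun j => ?_
    by_cases hj : j = i
    · subst hj
      simp
      linarith
    · simpa [hj] using hz j

lemma isStable_or_eq_zero_of_add_smul {σ : Type*} [Finite σ] (p q : MvPolynomial σ ℂ) (c : ℂ)
    (h : ∀ ε : ℝ, 0 < ε → IsStable (p + ((ε : ℂ) * c) • q)) : IsStable p ∨ p = 0 := by
  have hε : ∀ k : ℕ, (0 : ℝ) < 1 / ((k : ℝ) + 1) := fun k => Nat.one_div_pos_of_nat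
  refine isStable_or_eq_zero_of_tendstoUniformlyOn
    (fun k : ℕ => p + (((1 / ((k : ℝ) + 1) : ℝ) : ℂ) * c) • q) p (fun k => Or.inl (h _ (hε k))) ?_
  intro K hK
  obtain ⟨M, hM⟩ := hK.exists_bound_of_continuousOn (f := fun z => c * eval z q)
    (by have := MvPolynomial.continuous_eval q; fun_prop)
  have hM0 : M < |M| + 1 := by linarith [le_abs_self M]
  rw [Metric.tendstoUniformlyOn_iff]
  intro ε hε'
  have := (tendsto_one_div_add_atTop_nhds_zero_nat (𝕜 := ℝ)).eventually
    (gt_mem_nhds (div_pos hε' (by positivity : 0 < |M| + 1)))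
  filter_upwards [this] with k hk z hz
  rw [dist_eq_norm, map_add, smul_eval, sub_add_cancel_left, norm_neg, mul_assoc, norm_mul,
    Complex.norm_real, Real.norm_of_nonneg (hε k).le]
  rw [lt_div_iff₀ (by positivity)] at hk
  refine lt_of_le_of_lt (mul_le_mul_of_nonneg_left ((hM z hz).trans hM0.le) (hε k).le) hk

/-- One step of the Lieb–Sokal substitution `xᵢ ↦ -∂ⱼ`, for polynomials of degree at most `d`
in `xᵢ`. -/
noncomputable def liebSokalStep {σ : Type*} (i j : σ) (d : ℕ) (p : MvPolynomial σ ℂ) :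
    MvPolynomial σ ℂ :=
  p - (d : ℂ)⁻¹ • (X i * pderiv i p) - (d : ℂ)⁻¹ • pderiv j (pderiv i p)

lemma isStable_polar {σ : Type*} (p : MvPolynomial σ ℂ) (hp : IsStable p) (i : σ) (d : ℕ)
    (hd0 : 0 < d) (hd : degreeOf i p ≤ d) (ζ : ℂ) (hζ : 0 < ζ.im) (z : σ → ℂ)
    (hz : ∀ j, 0 < (z j).im) :
    eval z p - (d : ℂ)⁻¹ * (z i * eval z (pderiv i p)) +
      ζ * ((d : ℂ)⁻¹ * eval z (pderiv i p)) ≠ 0 := by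
  have hb := logDeriv_bound_of_isStable p hp i z hz d hd
  have hpz := hp z hz
  set s := eval z (pderiv i p) / eval z p with hs
  have hs' : eval z (pderiv i p) = s * eval z p := by rw [hs, div_mul_cancel₀ _ hpz]
  have hdpos : (0 : ℝ) < d := Nat.cast_pos.2 hd0
  have hdc : (d : ℂ) ≠ 0 := Nat.cast_ne_zero.2 hd0.ne'
  intro h
  rw [hs'] at h
  have h1 : (d : ℂ) + (ζ - z i) * s = 0 := by
    field_simp at h
    rcases mul_eq_zero.1 (by linear_combination h :
      eval z p * ((d : ℂ) + (ζ - z i) * s) = 0) with h | h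
    · exact absurd h hpz
    · exact h
  have hs0 : s ≠ 0 := by rintro h0; simp [h0] at h1; omega
  have hN : 0 < Complex.normSq s := Complex.normSq_pos.2 hs0
  have h2 : ζ = z i - d * s⁻¹ := by
    field_simp
    linear_combination h1
  have h3 : ζ.im = (z i).im + d * (s.im / Complex.normSq s) := by
    rw [h2]; simp [Complex.inv_im]; ring
  have h4 : ζ.im * Complex.normSq s = (z i).im * Complex.normSq s + d * s.im := by
    rw [h3]; field_simp
  have := mul_pos hζ hN
  linarith

lemma isStable_or_eq_zero_liebSokalStep {σ : Type*} [Finite σ] (p : MvPolynomial σ ℂ)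
    (hp : IsStable p) (i j : σ) (d : ℕ) (hd0 : 0 < d) (hd : degreeOf i p ≤ d) :
    IsStable (liebSokalStep i j d p) ∨ liebSokalStep i j d p = 0 := by
  have hpol := isStable_polar p hp i d hd0 hd
  set A := p - (d : ℂ)⁻¹ • (X i * pderiv i p) with hA
  set B := (d : ℂ)⁻¹ • pderiv i p with hB
  have hAB : ∀ ζ : ℂ, 0 < ζ.im → ∀ z : σ → ℂ, (∀ j, 0 < (z j).im) →
      eval z A + ζ * eval z B ≠ 0 := by
    intro ζ hζ z hz
    have := hpol ζ hζ z hz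
    simpa [hA, hB, smul_eval] using this
  have hL : liebSokalStep i j d p = A - pderiv j B := by
    simp [liebSokalStep, hA, hB]
  rw [hL]
  clear_value A B
  have hBs : IsStable B ∨ B = 0 := by
    refine isStable_or_eq_zero_of_add_smul B A (-Complex.I) fun ε hε z hz h => ?_
    refine hAB (Complex.I / ε) ?_ z hz ?_
    · rw [Complex.div_ofReal_im]
      simpa using hε
    · have hε' : (ε : ℂ) ≠ 0 := Complex.ofReal_ne_zero.2 hε.ne'
      rw [map_add, smul_eval] at h
      field_simp
      linear_combination Complex.I * h + ε * eval z A * Complex.I_mul_I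
  rcases hBs with hBs | hB0
  · refine isStable_or_eq_zero_of_add_smul _ B Complex.I fun ε hε z hz h => ?_
    have hBz := hBs z hz
    have hb := logDeriv_bound_of_isStable B hBs j z hz (degreeOf j B) le_rfl
    set s := eval z (pderiv j B) / eval z B with hs
    have hs' : eval z (pderiv j B) = s * eval z B := by rw [hs, div_mul_cancel₀ _ hBz]
    have hsim : s.im ≤ 0 := by
      rcases Nat.eq_zero_or_pos (degreeOf j B) with h0 | h0
      · rw [h0] at hb
        have h1 : Complex.normSq s = 0 := by
          refine le_antisymm ?_ (Complex.normSq_nonneg _)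
          have := hz j
          simp at hb
          nlinarith
        rw [Complex.normSq_eq_zero.1 h1]
        simp
      · have h2 := (mul_nonneg (hz j).le (Complex.normSq_nonneg s)).trans hb
        have := nonneg_of_mul_nonneg_right h2 (Nat.cast_pos.2 h0)
        linarith
    refine hAB (-s + ε * Complex.I) ?_ z hz ?_
    · simp
      linarith
    · rw [map_add, map_sub, smul_eval, hs'] at h
      linear_combination h
  · left
    intro z hz
    have := hAB Complex.I (by simp) z hz
    simpa [hB0] using this

/-- The pairing weight of the monomial `x^a w^k u^l`, evaluated at `x`. -/
noncomputable def pairingWeight (x : ℂ) (a k l : ℕ) : ℂ :=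
  x ^ a * if k = l then (-1) ^ k * (k.factorial : ℂ) else 0

lemma pairingWeight_succ (x : ℂ) (a k l : ℕ) :
    pairingWeight x a (k + 1) (l + 1) = -((l + 1 : ℕ) : ℂ) * pairingWeight x a k l := by
  unfold pairingWeight
  by_cases h : k = l
  · subst h
    simp [pow_succ, Nat.factorial_succ]
    ring
  · simp [h]

lemma X_mul_pderiv_monomial' {σ : Type*} (i : σ) (m : σ →₀ ℕ) (c : ℂ) :
    X i * pderiv i (monomial m c) = monomial m (c * (m i : ℂ)) := by
  rw [X_mul_pderiv_monomial, smul_monomial, nsmul_eq_mul, mul_comm]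

/-- The linear functional `z^a w^k u^l ↦ z^a ((-∂)^k u^l)(0)`. -/
noncomputable def pairing {ι : Type*} [Fintype ι] (z : ι → ℂ) :
    MvPolynomial ((ι ⊕ ι) ⊕ ι) ℂ →ₗ[ℂ] ℂ :=
  (basisMonomials ((ι ⊕ ι) ⊕ ι) ℂ).constr ℂ fun m =>
    ∏ i, pairingWeight (z i) (m (.inl (.inl i))) (m (.inl (.inr i))) (m (.inr i))

lemma pairing_monomial {ι : Type*} [Fintype ι] (z : ι → ℂ) (m : (ι ⊕ ι) ⊕ ι →₀ ℕ) (c : ℂ) :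
    pairing z (monomial m c) =
      c * ∏ i, pairingWeight (z i) (m (.inl (.inl i))) (m (.inl (.inr i))) (m (.inr i)) := by
  have h : monomial m c = c • basisMonomials ((ι ⊕ ι) ⊕ ι) ℂ m := by
    rw [coe_basisMonomials, smul_monomial, smul_eq_mul, mul_one]
  rw [h, map_smul, pairing, Module.Basis.constr_basis, smul_eq_mul]

lemma pairing_pderiv {ι : Type*} [Fintype ι] (z : ι → ℂ) (i : ι)
    (p : MvPolynomial ((ι ⊕ ι) ⊕ ι) ℂ) :
    pairing z (X (.inl (.inr i)) * pderiv (.inl (.inr i)) p) +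
      pairing z (pderiv (.inr i) (pderiv (.inl (.inr i)) p)) = 0 := by
  classical
  induction p using MvPolynomial.induction_on' with
  | add p q hp hq =>
    simp only [map_add, mul_add]
    linear_combination hp + hq
  | monomial m c =>
    rw [X_mul_pderiv_monomial', pderiv_monomial, pderiv_monomial, pairing_monomial, pairing_monomial]
    rcases Nat.eq_zero_or_pos (m (.inl (.inr i))) with hk | hk
    · simp [hk]
    have hu : (m - Finsupp.single (.inl (.inr i)) 1 : (ι ⊕ ι) ⊕ ι →₀ ℕ) (.inr i) =
        m (.inr i) := by simp
    rw [hu]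
    rw [← Finset.mul_prod_erase Finset.univ _ (Finset.mem_univ i),
      ← Finset.mul_prod_erase Finset.univ _ (Finset.mem_univ i)]
    have herase : ∀ j ∈ Finset.univ.erase i,
        pairingWeight (z j) ((m - Finsupp.single (.inl (.inr i)) 1 -
          Finsupp.single (.inr i) 1 : (ι ⊕ ι) ⊕ ι →₀ ℕ) (.inl (.inl j)))
          ((m - Finsupp.single (.inl (.inr i)) 1 -
          Finsupp.single (.inr i) 1 : (ι ⊕ ι) ⊕ ι →₀ ℕ) (.inl (.inr j)))
          ((m - Finsupp.single (.inl (.inr i)) 1 -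
          Finsupp.single (.inr i) 1 : (ι ⊕ ι) ⊕ ι →₀ ℕ) (.inr j)) =
        pairingWeight (z j) (m (.inl (.inl j))) (m (.inl (.inr j))) (m (.inr j)) := by
      intro j hj
      have hji : i ≠ j := (Finset.ne_of_mem_erase hj).symm
      simp [hji]
    rw [Finset.prod_congr rfl herase]
    rcases Nat.eq_zero_or_pos (m (.inr i)) with hl | hl
    · simp [hl, pairingWeight, hk.ne']
    · obtain ⟨k, hk'⟩ := Nat.exists_eq_succ_of_ne_zero hk.ne'
      obtain ⟨l, hl'⟩ := Nat.exists_eq_succ_of_ne_zero hl.ne'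
      simp [hk', hl']
      rw [pairingWeight_succ]
      push_cast
      ring

lemma pairing_liebSokalStep {ι : Type*} [Fintype ι] (z : ι → ℂ) (i : ι) (d : ℕ)
    (p : MvPolynomial ((ι ⊕ ι) ⊕ ι) ℂ) :
    pairing z (liebSokalStep (.inl (.inr i)) (.inr i) d p) = pairing z p := by
  rw [liebSokalStep, map_sub, map_sub, map_smul, map_smul, smul_eq_mul, smul_eq_mul]
  linear_combination (-(d : ℂ)⁻¹) * pairing_pderiv z i p

lemma liebSokalStep_add {σ : Type*} (i j : σ) (d : ℕ) (p q : MvPolynomial σ ℂ) :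
    liebSokalStep i j d (p + q) = liebSokalStep i j d p + liebSokalStep i j d q := by
  simp only [liebSokalStep, map_add, mul_add, smul_add]
  ring

/-- The polynomials whose degree in the variable `w i` is at most `D i`. -/
noncomputable def degreeBound {ι : Type*} (D : ι → ℕ) :
    Submodule ℂ (MvPolynomial ((ι ⊕ ι) ⊕ ι) ℂ) :=
  restrictSupport ℂ {m | ∀ i, m (.inl (.inr i)) ≤ D i}

lemma degreeBound_induction {ι : Type*} {D : ι → ℕ}
    {P : MvPolynomial ((ι ⊕ ι) ⊕ ι) ℂ → Prop} (h0 : P 0)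
    (hadd : ∀ p q, P p → P q → P (p + q))
    (hmon : ∀ (m : (ι ⊕ ι) ⊕ ι →₀ ℕ) (c : ℂ), (∀ i, m (.inl (.inr i)) ≤ D i) →
      P (monomial m c)) (p : MvPolynomial ((ι ⊕ ι) ⊕ ι) ℂ) (hp : p ∈ degreeBound D) : P p := by
  rw [p.as_sum]
  refine Finset.sum_induction _ P hadd h0 fun m hm => hmon m _ ?_
  exact (mem_restrictSupport_iff ℂ).1 hp hm

lemma liebSokalStep_mem_degreeBound {ι : Type*} [DecidableEq ι] (D : ι → ℕ) (i : ι)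
    (hi : 0 < D i) (p : MvPolynomial ((ι ⊕ ι) ⊕ ι) ℂ) (hp : p ∈ degreeBound D) :
    liebSokalStep (.inl (.inr i)) (.inr i) (D i) p ∈
      degreeBound (Function.update D i (D i - 1)) := by
  let P : MvPolynomial ((ι ⊕ ι) ⊕ ι) ℂ → Prop := fun p =>
    liebSokalStep (.inl (.inr i)) (.inr i) (D i) p ∈ degreeBound (Function.update D i (D i - 1))
  have key : ∀ p ∈ degreeBound D, P p := degreeBound_induction ?_ ?_ ?_
  · exact key p hp
  · simp [P, liebSokalStep]
  · intro p q hp hq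
    simp only [P] at hp hq ⊢
    rw [liebSokalStep_add]
    exact add_mem hp hq
  · intro m c hm
    have hD : (D i : ℂ) ≠ 0 := Nat.cast_ne_zero.2 hi.ne'
    simp only [P]
    rw [liebSokalStep, X_mul_pderiv_monomial']
    refine sub_mem ?_ (Submodule.smul_mem _ _ ?_)
    · rw [smul_monomial, ← map_sub]
      rcases (hm i).eq_or_lt with h | h
      · rw [h, smul_eq_mul, show c - (D i : ℂ)⁻¹ * (c * (D i : ℂ)) = 0 by field_simp; ring]
        simp
      · refine (monomial_mem_restrictSupport ℂ).2 (Or.inl fun j => ?_)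
        by_cases hj : j = i
        · subst hj
          simp
          omega
        · simpa [hj] using hm j
    · rw [pderiv_monomial, pderiv_monomial]
      refine (monomial_mem_restrictSupport ℂ).2 (Or.inl fun j => ?_)
      by_cases hj : j = i
      · subst hj
        have := hm j
        simp
        omega
      · simpa [hj, Ne.symm hj] using hm j

lemma degreeOf_le_of_mem_degreeBound {ι : Type*} (D : ι → ℕ) (i : ι)
    (p : MvPolynomial ((ι ⊕ ι) ⊕ ι) ℂ) (hp : p ∈ degreeBound D) :
    degreeOf (.inl (.inr i)) p ≤ D i := by
  rw [degreeOf_le_iff]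
  intro m hm
  exact (mem_restrictSupport_iff ℂ).1 hp hm i

lemma exists_degreeBound_zero {ι : Type*} [Fintype ι] (N : ℕ) (D : ι → ℕ) (hN : ∑ i, D i = N)
    (p : MvPolynomial ((ι ⊕ ι) ⊕ ι) ℂ) (hp : IsStable p ∨ p = 0) (hpD : p ∈ degreeBound D) :
    ∃ q : MvPolynomial ((ι ⊕ ι) ⊕ ι) ℂ, (IsStable q ∨ q = 0) ∧
      q ∈ degreeBound (fun _ : ι => 0) ∧ ∀ z, pairing z q = pairing z p := by
  classical
  induction N generalizing D p with
  | zero =>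
    refine ⟨p, hp, ?_, fun _ => rfl⟩
    have : D = fun _ => 0 := by
      funext i
      exact (Finset.sum_eq_zero_iff.1 hN) i (Finset.mem_univ i)
    rwa [← this]
  | succ N ih =>
    obtain ⟨i, hi⟩ : ∃ i, 0 < D i := by
      by_contra! h
      simp [fun i => Nat.le_zero.1 (h i)] at hN
    obtain ⟨q, hq1, hq2, hq3⟩ := ih (Function.update D i (D i - 1)) (by
      rw [Finset.sum_update_of_mem (Finset.mem_univ i)]
      rw [← Finset.add_sum_erase _ _ (Finset.mem_univ i), Finset.erase_eq] at hN
      omega) (liebSokalStep (.inl (.inr i)) (.inr i) (D i) p) (by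
      rcases hp with hp | rfl
      · exact isStable_or_eq_zero_liebSokalStep p hp _ _ _ hi
          (degreeOf_le_of_mem_degreeBound D i p hpD)
      · right; simp [liebSokalStep]) (liebSokalStep_mem_degreeBound D i hi p hpD)
    exact ⟨q, hq1, hq2, fun z => by rw [hq3, pairing_liebSokalStep]⟩

lemma pairing_eq_eval {ι : Type*} [Fintype ι] (z : ι → ℂ)
    (p : MvPolynomial ((ι ⊕ ι) ⊕ ι) ℂ) (hp : p ∈ degreeBound (fun _ : ι => 0)) :
    pairing z p = eval (Sum.elim (Sum.elim z 0) 0) p := by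
  refine degreeBound_induction (P := fun p => pairing z p = eval (Sum.elim (Sum.elim z 0) 0) p)
    (by simp) (fun p q hp hq => by rw [map_add, map_add, hp, hq]) (fun m c hm => ?_) p hp
  rw [pairing_monomial, eval_monomial, Finsupp.prod_fintype _ _ (by simp)]
  congr 1
  rw [Fintype.prod_sum_type, Fintype.prod_sum_type, ← Finset.prod_mul_distrib,
    ← Finset.prod_mul_distrib]
  refine Finset.prod_congr rfl fun i _ => ?_
  have h0 : m (.inl (.inr i)) = 0 := Nat.le_zero.1 (hm i)
  rcases Nat.eq_zero_or_pos (m (.inr i)) with hl | hl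
  · simp [pairingWeight, h0, hl]
  · simp [pairingWeight, h0, hl.ne', hl.ne]

/-- Specializing some variables of a stable polynomial to `0` gives a stable polynomial or `0`. -/
lemma exists_isStable_or_eq_zero_eval_elim {ι κ : Type*} [Finite ι] [Finite κ]
    (p : MvPolynomial (ι ⊕ κ) ℂ) (hp : IsStable p ∨ p = 0) :
    ∃ q : MvPolynomial ι ℂ, (IsStable q ∨ q = 0) ∧
      ∀ z, eval z q = eval (Sum.elim z 0) p := by
  let S : ℂ → MvPolynomial ι ℂ := fun c => aeval (Sum.elim X fun _ => C c) p
  have hS : ∀ c z, eval z (S c) = eval (Sum.elim z fun _ => c) p := by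
    intro c z
    simp only [S]
    rw [← MvPolynomial.coe_aeval_eq_eval, ← MvPolynomial.coe_aeval_eq_eval]
    simp only [RingHom.coe_coe]
    rw [← AlgHom.comp_apply, comp_aeval]
    congr 2
    funext j
    rcases j with j | j <;> simp
  refine ⟨S 0, ?_, fun z => by rw [hS]; rfl⟩
  rcases hp with hp | rfl
  swap
  · right; simp [S]
  have hε : ∀ k : ℕ, (0 : ℝ) < 1 / ((k : ℝ) + 1) := fun k => Nat.one_div_pos_of_nat
  refine isStable_or_eq_zero_of_tendstoUniformlyOn
    (fun k => S (((1 / ((k : ℝ) + 1) : ℝ) : ℂ) * Complex.I)) _ (fun k => Or.inl ?_) ?_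
  · intro z hz
    rw [hS]
    refine hp _ fun j => ?_
    rcases j with j | j
    · exact hz j
    · simp only [Sum.elim_inr, Complex.im_ofReal_mul, Complex.I_im, mul_one]
      exact hε k
  · intro K hK
    simp only [hS]
    have hc : Continuous fun x : ℂ × (ι → ℂ) => eval (Sum.elim x.2 fun _ : κ => x.1) p := by
      refine (MvPolynomial.continuous_eval p).comp (continuous_pi fun j => ?_)
      rcases j with j | j <;> simp <;> fun_prop
    have ht : Filter.Tendsto (fun k : ℕ => ((1 / ((k : ℝ) + 1) : ℝ) : ℂ) * Complex.I)
        Filter.atTop (nhds 0) := by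
      have := (Complex.continuous_ofReal.tendsto 0).comp
        (tendsto_one_div_add_atTop_nhds_zero_nat (𝕜 := ℝ))
      simpa using this.mul_const Complex.I
    have hu : TendstoUniformlyOn (fun c z => eval (Sum.elim z fun _ : κ => c) p)
        (fun z => eval (Sum.elim z fun _ : κ => (0 : ℂ)) p) (nhds (0 : ℂ)) K := by
      have huc := ((isCompact_closedBall (0 : ℂ) 1).prod hK).uniformContinuousOn_of_continuous
        hc.continuousOn
      have := UniformContinuousOn.tendstoUniformlyOn
        (F := fun (c : ℂ) z => eval (Sum.elim z fun _ : κ => c) p) huc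
        (Metric.mem_closedBall_self zero_le_one)
      rwa [nhdsWithin_eq_nhds.2 (Metric.closedBall_mem_nhds _ one_pos)] at this
    exact fun u hu' => ht.eventually (hu u hu')

/-- The normalized Haar measure on the torus. -/
noncomputable abbrev torusMeasure (ι : Type*) [Fintype ι] :
    MeasureTheory.Measure (ι → AddCircle (1 : ℝ)) :=
  MeasureTheory.Measure.pi fun _ => AddCircle.haarAddCircle

/-- The standard embedding of the torus. -/
noncomputable def torusPoint {ι : Type*} (t : ι → AddCircle (1 : ℝ)) (i : ι) : ℂ :=
  fourier 1 (t i)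

lemma norm_torusPoint {ι : Type*} (t : ι → AddCircle (1 : ℝ)) (i : ι) :
    ‖torusPoint t i‖ = 1 := by
  simp [torusPoint, Circle.norm_coe]

lemma continuous_torusPoint {ι : Type*} : Continuous (torusPoint (ι := ι)) := by
  unfold torusPoint
  fun_prop

/-- The kernel extracting `(-1)^{|b|} b!` times the coefficient of `w^b`. -/
noncomputable def coeffKernel {ι : Type*} [Fintype ι] (b : ι →₀ ℕ)
    (t : ι → AddCircle (1 : ℝ)) : ℂ :=
  ∏ i, ((-1) ^ b i * ((b i).factorial : ℂ)) * fourier (-(b i : ℤ)) (t i)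

lemma continuous_coeffKernel {ι : Type*} [Fintype ι] (b : ι →₀ ℕ) :
    Continuous (coeffKernel b) := by
  unfold coeffKernel
  fun_prop

lemma norm_coeffKernel {ι : Type*} [Fintype ι] (b : ι →₀ ℕ) (t : ι → AddCircle (1 : ℝ)) :
    ‖coeffKernel b t‖ = ∏ i, ((b i).factorial : ℝ) := by
  simp [coeffKernel, norm_prod, Circle.norm_coe]

lemma integral_fourier_one_pow_mul (k b : ℕ) :
    ∫ x : AddCircle (1 : ℝ), (fourier 1 x) ^ k * fourier (-(b : ℤ)) x ∂AddCircle.haarAddCircle =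
      if k = b then 1 else 0 := by
  have h := congrFun (fourierCoeff_fourier (T := 1) (k : ℤ)) (b : ℤ)
  rw [fourierCoeff] at h
  have hk : ∀ x : AddCircle (1 : ℝ), fourier 1 x ^ k = fourier (k : ℤ) x := by
    intro x
    induction k with
    | zero => simp
    | succ k ih =>
      rw [pow_succ, ih (congrFun (fourierCoeff_fourier (T := 1) (k : ℤ)) (b : ℤ)), Nat.cast_succ,
        fourier_add]
  simp only [hk]
  simp only [smul_eq_mul] at h
  simp only [mul_comm (fourier (k : ℤ) _)]
  rw [h, Pi.single_apply]
  simp [eq_comm]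

lemma integral_prod_torusPoint_pow_mul {ι : Type*} [Fintype ι] (m : ι → ℕ) (b : ι →₀ ℕ) :
    ∫ t, (∏ i, torusPoint t i ^ m i) * coeffKernel b t ∂torusMeasure ι =
      ∏ i, if m i = b i then (-1) ^ m i * ((m i).factorial : ℂ) else 0 := by
  simp only [torusPoint, coeffKernel, ← Finset.prod_mul_distrib]
  rw [MeasureTheory.integral_fintype_prod_eq_prod (fun i x =>
    fourier 1 x ^ m i * ((-1) ^ b i * ((b i).factorial : ℂ) * fourier (-(b i : ℤ)) x))]
  refine Finset.prod_congr rfl fun i _ => ?_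
  have : ∀ x : AddCircle (1 : ℝ),
      fourier 1 x ^ m i * ((-1) ^ b i * ((b i).factorial : ℂ) * fourier (-(b i : ℤ)) x) =
      ((-1) ^ b i * ((b i).factorial : ℂ)) * (fourier 1 x ^ m i * fourier (-(b i : ℤ)) x) :=
    fun x => by ring
  simp only [this]
  rw [MeasureTheory.integral_const_mul, integral_fourier_one_pow_mul]
  split_ifs with h
  · rw [h, mul_one]
  · simp

lemma continuous_eval_torusPoint {ι : Type*} (z : ι → ℂ) (g : MvPolynomial (ι ⊕ ι) ℂ) :
    Continuous fun t => eval (Sum.elim z (torusPoint t)) g := by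
  refine (MvPolynomial.continuous_eval g).comp (continuous_pi fun j => ?_)
  rcases j with j | j
  · exact continuous_const
  · exact (continuous_apply j).comp continuous_torusPoint

lemma integrable_of_continuous_torus {ι : Type*} [Fintype ι] (f : (ι → AddCircle (1 : ℝ)) → ℂ)
    (hf : Continuous f) : MeasureTheory.Integrable f (torusMeasure ι) :=
  hf.integrable_of_hasCompactSupport (HasCompactSupport.of_compactSpace f)

lemma pairing_mul_monomial {ι : Type*} [Fintype ι] (z : ι → ℂ) (g : MvPolynomial (ι ⊕ ι) ℂ)
    (b : ι →₀ ℕ) (c : ℂ) :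
    pairing z (rename Sum.inl g * rename Sum.inr (monomial b c)) =
      c * ∫ t, eval (Sum.elim z (torusPoint t)) g * coeffKernel b t ∂torusMeasure ι := by
  induction g using MvPolynomial.induction_on' with
  | add p q hp hq =>
    rw [map_add, add_mul, map_add, hp, hq, ← mul_add, ← MeasureTheory.integral_add]
    · simp only [map_add, add_mul]
    · exact integrable_of_continuous_torus _
        ((continuous_eval_torusPoint z p).mul (continuous_coeffKernel b))
    · exact integrable_of_continuous_torus _
        ((continuous_eval_torusPoint z q).mul (continuous_coeffKernel b))
  | monomial m a =>
    rw [rename_monomial, rename_monomial, monomial_mul, pairing_monomial]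
    have h1 : ∀ t, eval (Sum.elim z (torusPoint t)) (monomial m a) * coeffKernel b t =
        (a * ∏ i, z i ^ m (.inl i)) *
          ((∏ i, torusPoint t i ^ m (.inr i)) * coeffKernel b t) := by
      intro t
      rw [eval_monomial, Finsupp.prod_fintype _ _ (by simp), Fintype.prod_sum_type]
      simp only [Sum.elim_inl, Sum.elim_inr]
      ring
    simp only [h1]
    rw [MeasureTheory.integral_const_mul, integral_prod_torusPoint_pow_mul]
    simp only [Finsupp.add_apply, pairingWeight]
    have e1 : ∀ j, Finsupp.mapDomain Sum.inl m (Sum.inl j : (ι ⊕ ι) ⊕ ι) = m j :=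
      fun j => Finsupp.mapDomain_apply Sum.inl_injective _ _
    have e2 : ∀ j, Finsupp.mapDomain Sum.inr b (Sum.inr j : (ι ⊕ ι) ⊕ ι) = b j :=
      fun j => Finsupp.mapDomain_apply Sum.inr_injective _ _
    have e3 : ∀ j, Finsupp.mapDomain Sum.inr b (Sum.inl j : (ι ⊕ ι) ⊕ ι) = 0 :=
      fun j => Finsupp.mapDomain_of_notMem_range _ _ (by simp)
    have e4 : ∀ j, Finsupp.mapDomain Sum.inl m (Sum.inr j : (ι ⊕ ι) ⊕ ι) = 0 :=
      fun j => Finsupp.mapDomain_of_notMem_range _ _ (by simp)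
    simp only [e1, e2, e3, e4, add_zero, zero_add]
    rw [Finset.prod_mul_distrib]
    ring

lemma isStable_rename {σ τ : Type*} (e : σ → τ) (p : MvPolynomial σ ℂ) (hp : IsStable p) :
    IsStable (rename e p) := by
  intro z hz
  rw [eval_rename]
  exact hp _ fun i => hz _

lemma IsStable.mul {σ : Type*} {p q : MvPolynomial σ ℂ} (hp : IsStable p) (hq : IsStable q) :
    IsStable (p * q) := by
  intro z hz
  rw [map_mul]
  exact mul_ne_zero (hp z hz) (hq z hz)

/-- The Lieb–Sokal lemma: the polynomial `(g(z, -∂) f)(0)` is stable or zero. -/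
lemma exists_isStable_or_eq_zero_pairing {ι : Type*} [Fintype ι] (g : MvPolynomial (ι ⊕ ι) ℂ)
    (f : MvPolynomial ι ℂ) (hg : IsStable g) (hf : IsStable f) :
    ∃ h : MvPolynomial ι ℂ, (IsStable h ∨ h = 0) ∧ ∀ z, eval z h = ∑ b ∈ f.support,
      f.coeff b * ∫ t, eval (Sum.elim z (torusPoint t)) g * coeffKernel b t ∂torusMeasure ι := by
  set p : MvPolynomial ((ι ⊕ ι) ⊕ ι) ℂ := rename Sum.inl g * rename Sum.inr f with hp
  have hps : IsStable p := (isStable_rename _ g hg).mul (isStable_rename _ f hf)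
  obtain ⟨q, hq1, hq2, hq3⟩ := exists_degreeBound_zero _ (fun i => degreeOf (.inl (.inr i)) p) rfl p
    (Or.inl hps) ((mem_restrictSupport_iff ℂ).2 fun m hm i => monomial_le_degreeOf _ hm)
  obtain ⟨r, hr1, hr2⟩ := exists_isStable_or_eq_zero_eval_elim q hq1
  obtain ⟨h, hh1, hh2⟩ := exists_isStable_or_eq_zero_eval_elim r hr1
  refine ⟨h, hh1, fun z => ?_⟩
  rw [hh2, hr2, ← pairing_eq_eval z q hq2, hq3, hp]
  conv_lhs => rw [f.as_sum]
  rw [map_sum, Finset.mul_sum, map_sum]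
  exact Finset.sum_congr rfl fun b _ => pairing_mul_monomial z g b _

lemma integral_mul_coeffKernel_of_hasSum {ι : Type*} [Fintype ι] (c : (ι →₀ ℕ) → ℂ)
    (F : (ι → ℂ) → ℂ) (hF : ∀ w, HasSum (fun α => c α * ∏ i, w i ^ α i) (F w)) (b : ι →₀ ℕ) :
    ∫ t, F (torusPoint t) * coeffKernel b t ∂torusMeasure ι =
      c b * ∏ i, ((-1) ^ b i * ((b i).factorial : ℂ)) := by
  have hsum : Summable fun α => ‖c α‖ := by
    have := (hF 1).summable.norm
    simpa using this
  have h := MeasureTheory.hasSum_integral_of_summable_integral_norm (μ := torusMeasure ι)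
    (F := fun (α : ι →₀ ℕ) t => c α * ((∏ i, torusPoint t i ^ α i) * coeffKernel b t)) ?_ ?_
  · have h1 : ∀ t, ∑' α : ι →₀ ℕ, c α * ((∏ i, torusPoint t i ^ α i) * coeffKernel b t) =
        F (torusPoint t) * coeffKernel b t := by
      intro t
      have := (hF (torusPoint t)).mul_right (coeffKernel b t)
      simpa only [mul_assoc] using this.tsum_eq
    simp only [h1] at h
    refine h.unique ?_
    simp only [MeasureTheory.integral_const_mul, integral_prod_torusPoint_pow_mul]
    convert hasSum_single b ?_ using 1
    · simp
    · intro α hα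
      obtain ⟨i, hi⟩ : ∃ i, α i ≠ b i := by
        by_contra! h
        exact hα (Finsupp.ext h)
      rw [Finset.prod_eq_zero (Finset.mem_univ i) (by simp [hi]), mul_zero]
  · intro α
    refine integrable_of_continuous_torus _ ?_
    have := continuous_coeffKernel b
    have := continuous_torusPoint (ι := ι)
    fun_prop
  · have h2 : ∀ (α : ι →₀ ℕ) t, ‖c α * ((∏ i, torusPoint t i ^ α i) * coeffKernel b t)‖ =
        ‖c α‖ * ∏ i, ((b i).factorial : ℝ) := by
      intro α t
      simp [norm_prod, norm_torusPoint, norm_coeffKernel]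
    simp only [h2]
    simpa using hsum.mul_right _

/-- An operator whose transcendental symbol is a limit of stable polynomials preserves
stability. -/
lemma isStable_or_eq_zero_of_transSymbol {n : ℕ}
    (T : MvPolynomial (Fin n) ℂ →ₗ[ℂ] MvPolynomial (Fin n) ℂ) (F : (Fin n ⊕ Fin n → ℂ) → ℂ)
    (hF : ∀ zw, HasSum (fun α : Fin n →₀ ℕ => transSymbolTerm T α zw) (F zw))
    (g : ℕ → MvPolynomial (Fin n ⊕ Fin n) ℂ) (hg : ∀ k, IsStable (g k))
    (hlim : ∀ K : Set (Fin n ⊕ Fin n → ℂ), IsCompact K →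
      TendstoUniformlyOn (fun k zw => eval zw (g k)) F Filter.atTop K)
    (f : MvPolynomial (Fin n) ℂ) (hf : IsStable f) : IsStable (T f) ∨ T f = 0 := by
  choose h hh1 hh2 using fun k => exists_isStable_or_eq_zero_pairing (g k) f (hg k) hf
  have hT : ∀ z, eval z (T f) = ∑ b ∈ f.support, f.coeff b *
      ∫ t, F (Sum.elim z (torusPoint t)) * coeffKernel b t ∂torusMeasure (Fin n) := by
    intro z
    conv_lhs => rw [f.as_sum]
    rw [map_sum, map_sum]
    refine Finset.sum_congr rfl fun b _ => ?_
    rw [integral_mul_coeffKernel_of_hasSum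
      (fun α => ((-1 : ℂ) ^ (α.sum fun _ k => k) / (α.prod fun _ k => (k.factorial : ℂ))) *
        eval z (T (monomial α 1))) (fun w => F (Sum.elim z w)) (fun w => by
          simpa [transSymbolTerm, Sum.elim_comp_inl] using hF (Sum.elim z w)) b]
    have h1 : monomial b (f.coeff b) = f.coeff b • monomial b (1 : ℂ) := by
      rw [smul_monomial, smul_eq_mul, mul_one]
    rw [h1, map_smul, smul_eval, Finset.prod_mul_distrib, Finset.prod_pow_eq_pow_sum,
      Finsupp.sum_fintype _ _ (by simp), Finsupp.prod_fintype _ _ (by simp)]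
    have h2 : (∏ i, ((b i).factorial : ℂ)) ≠ 0 :=
      Finset.prod_ne_zero_iff.2 fun i _ => Nat.cast_ne_zero.2 (Nat.factorial_ne_zero _)
    have h3 : ((-1 : ℂ) ^ ∑ i, b i) * (-1) ^ ∑ i, b i = 1 := by
      rw [← mul_pow]; simp
    field_simp
    linear_combination (-(coeff b f * eval z (T (monomial b 1)))) * h3
  refine isStable_or_eq_zero_of_tendstoUniformlyOn h (T f) hh1 fun K hK => ?_
  simp only [hh2, hT]
  set K' : Set (Fin n ⊕ Fin n → ℂ) :=
    (fun x : (Fin n → ℂ) × (Fin n → AddCircle (1 : ℝ)) => Sum.elim x.1 (torusPoint x.2)) ''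
      (K ×ˢ Set.univ) with hK'
  have hK'c : IsCompact K' := by
    refine (hK.prod isCompact_univ).image (continuous_pi fun j => ?_)
    rcases j with j | j
    · exact (continuous_apply j).comp continuous_fst
    · exact (continuous_apply j).comp (continuous_torusPoint.comp continuous_snd)
  have hmem : ∀ z ∈ K, ∀ t, Sum.elim z (torusPoint t) ∈ K' := fun z hz t =>
    ⟨(z, t), ⟨hz, trivial⟩, rfl⟩
  have hlimK := hlim K' hK'c
  have hFc : ContinuousOn F K' := hlimK.continuousOn
    (Filter.Frequently.of_forall fun k => (MvPolynomial.continuous_eval (g k)).continuousOn)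
  have hFt : ∀ z ∈ K, Continuous fun t => F (Sum.elim z (torusPoint t)) := by
    intro z hz
    refine hFc.comp_continuous (continuous_pi fun j => ?_) (hmem z hz)
    rcases j with j | j
    · exact continuous_const
    · exact (continuous_apply j).comp continuous_torusPoint
  set M : ℝ := ∑ b ∈ f.support, ‖f.coeff b‖ * ∏ i, ((b i).factorial : ℝ) with hM
  have hM0 : 0 ≤ M := by positivity
  rw [Metric.tendstoUniformlyOn_iff] at hlimK ⊢
  intro ε hε
  filter_upwards [hlimK (ε / (M + 1)) (by positivity)] with k hk z hz
  rw [dist_eq_norm, ← Finset.sum_sub_distrib]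
  have hterm : ∀ b ∈ f.support, ‖f.coeff b * (∫ t, F (Sum.elim z (torusPoint t)) *
      coeffKernel b t ∂torusMeasure (Fin n)) - f.coeff b * ∫ t,
        eval (Sum.elim z (torusPoint t)) (g k) * coeffKernel b t ∂torusMeasure (Fin n)‖ ≤
      (‖f.coeff b‖ * ∏ i, ((b i).factorial : ℝ)) * (ε / (M + 1)) := by
    intro b _
    rw [← mul_sub, norm_mul, mul_assoc]
    refine mul_le_mul_of_nonneg_left ?_ (norm_nonneg _)
    rw [← MeasureTheory.integral_sub]
    · refine (MeasureTheory.norm_integral_le_of_norm_le_const (μ := torusMeasure (Fin n))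
        (C := (∏ i, ((b i).factorial : ℝ)) * (ε / (M + 1))) (Filter.Eventually.of_forall
          fun t => ?_)).trans ?_
      · rw [← sub_mul, norm_mul, norm_coeffKernel, mul_comm]
        refine mul_le_mul_of_nonneg_left ?_ (by positivity)
        have := hk _ (hmem z hz t)
        rw [dist_eq_norm] at this
        exact this.le
      · simp
    · exact integrable_of_continuous_torus _ ((hFt z hz).mul (continuous_coeffKernel b))
    · exact integrable_of_continuous_torus _
        ((continuous_eval_torusPoint z (g k)).mul (continuous_coeffKernel b))
  refine (norm_sum_le_of_le _ hterm).trans_lt ?_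
  rw [← Finset.sum_mul, ← hM, ← mul_div_assoc, div_lt_iff₀ (by positivity)]
  nlinarith

lemma norm_one_add_le_exp (u : ℂ) : ‖1 + u‖ ≤ Real.exp (u.re + ‖u‖ ^ 2 / 2) := by
  refine abs_le_of_sq_le_sq' ?_ (Real.exp_pos _).le |>.2
  rw [← Real.exp_nat_mul, Complex.sq_norm, Complex.normSq_apply]
  refine le_trans (le_of_eq ?_) (Real.add_one_le_exp _)
  rw [Complex.sq_norm, Complex.normSq_apply]
  simp
  ring

lemma norm_multiset_prod_one_add_le (s : Multiset ℂ) (t : ℂ) :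
    ‖(s.map fun x => 1 + x * t).prod‖ ≤
      Real.exp ((s.sum * t).re + ‖t‖ ^ 2 * (s.map fun x => ‖x‖ ^ 2).sum / 2) := by
  induction s using Multiset.induction_on with
  | empty => simp
  | cons a s ih =>
    rw [Multiset.map_cons, Multiset.prod_cons, norm_mul]
    refine (mul_le_mul (norm_one_add_le_exp (a * t)) ih (norm_nonneg _)
      (Real.exp_pos _).le).trans_eq ?_
    rw [← Real.exp_add]
    congr 1
    rw [Multiset.sum_cons, Multiset.map_cons, Multiset.sum_cons, norm_mul, add_mul, Complex.add_re]
    ring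

lemma multiset_sum_normSq_le (s : Multiset ℂ) (hs : ∀ x ∈ s, x.im ≤ 0) :
    (s.map fun x => ‖x‖ ^ 2).sum ≤ ‖(s.map fun x => x ^ 2).sum‖ + 2 * ‖s.sum‖ ^ 2 := by
  have key : s.sum.im ≤ 0 ∧ (s.map fun x => ‖x‖ ^ 2).sum ≤
      ((s.map fun x => x ^ 2).sum).re + 2 * s.sum.im ^ 2 := by
    induction s using Multiset.induction_on with
    | empty => simp
    | cons a s ih =>
      obtain ⟨h1, h2⟩ := ih fun x hx => hs x (Multiset.mem_cons_of_mem hx)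
      have ha := hs a (Multiset.mem_cons_self a s)
      simp only [Multiset.map_cons, Multiset.sum_cons, Complex.add_re, Complex.add_im]
      refine ⟨by linarith, ?_⟩
      have : ‖a‖ ^ 2 = (a ^ 2).re + 2 * a.im ^ 2 := by
        rw [Complex.sq_norm, Complex.normSq_apply, sq, Complex.mul_re]
        ring
      rw [this]
      nlinarith [mul_nonneg_of_nonpos_of_nonpos ha h1]
  refine key.2.trans (add_le_add (Complex.re_le_norm _) ?_)
  rw [Complex.sq_norm, Complex.normSq_apply]
  nlinarith [mul_self_nonneg s.sum.re]

lemma coeff_multiset_prod_one_add (s : Multiset ℂ) :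
    ((s.map fun x => 1 + Polynomial.C x * Polynomial.X).prod).coeff 0 = 1 ∧
    ((s.map fun x => 1 + Polynomial.C x * Polynomial.X).prod).coeff 1 = s.sum ∧
    2 * ((s.map fun x => 1 + Polynomial.C x * Polynomial.X).prod).coeff 2 =
      s.sum ^ 2 - (s.map fun x => x ^ 2).sum := by
  induction s using Multiset.induction_on with
  | empty => simp [Polynomial.coeff_one]
  | cons a s ih =>
    obtain ⟨h0, h1, h2⟩ := ih
    simp only [Multiset.map_cons, Multiset.prod_cons, Multiset.sum_cons, add_mul, one_mul,
      mul_assoc, Polynomial.coeff_add, Polynomial.coeff_C_mul]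
    set P := (s.map fun x => 1 + Polynomial.C x * Polynomial.X).prod
    have e2 : (Polynomial.X * P).coeff 2 = P.coeff 1 := Polynomial.coeff_X_mul P 1
    have e1 : (Polynomial.X * P).coeff 1 = P.coeff 0 := Polynomial.coeff_X_mul P 0
    have e0 : (Polynomial.X * P).coeff 0 = 0 := Polynomial.coeff_X_mul_zero P
    rw [e0, e1, e2, h0, h1, mul_add, h2]
    refine ⟨by simp, by ring, by ring⟩

lemma exists_multiset_eq_prod_one_add (Q : Polynomial ℂ) (h0 : Q.coeff 0 ≠ 0)
    (hQ : ∀ t : ℂ, 0 < t.im → Q.eval t ≠ 0) :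
    ∃ s : Multiset ℂ, (∀ x ∈ s, x.im ≤ 0) ∧
      Q = Polynomial.C (Q.coeff 0) * (s.map fun x => 1 + Polynomial.C x * Polynomial.X).prod := by
  have hQ0 : Q ≠ 0 := fun h => h0 (by simp [h])
  have hroot : ∀ r ∈ Q.roots, r ≠ 0 ∧ r.im ≤ 0 := by
    intro r hr
    rw [Polynomial.mem_roots hQ0, Polynomial.IsRoot] at hr
    refine ⟨fun h => h0 ?_, not_lt.mp fun h => hQ r h hr⟩
    rwa [h, ← Polynomial.coeff_zero_eq_eval_zero] at hr
  have hfac : Q = Polynomial.C (Q.leadingCoeff * (Q.roots.map fun r => -r).prod) *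
      ((Q.roots.map fun r => -r⁻¹).map fun x => 1 + Polynomial.C x * Polynomial.X).prod := by
    conv_lhs => rw [(IsAlgClosed.splits Q).eq_prod_roots]
    rw [Polynomial.C_mul, mul_assoc]
    congr 1
    rw [map_multiset_prod, Multiset.map_map, Multiset.map_map,
      ← Multiset.prod_map_mul]
    refine congrArg Multiset.prod (Multiset.map_congr rfl fun r hr => ?_)
    have hr0 := (hroot r hr).1
    have : Polynomial.C r * Polynomial.C r⁻¹ = 1 := by
      rw [← Polynomial.C_mul, mul_inv_cancel₀ hr0, Polynomial.C_1]
    simp only [Function.comp, map_neg]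
    linear_combination (-Polynomial.X) * this
  refine ⟨Q.roots.map fun r => -r⁻¹, ?_, ?_⟩
  · intro x hx
    obtain ⟨r, hr, rfl⟩ := Multiset.mem_map.mp hx
    rw [Complex.neg_im, Complex.inv_im, neg_div, neg_neg]
    exact div_nonpos_of_nonpos_of_nonneg (hroot r hr).2 (Complex.normSq_nonneg r)
  · have hc := congrArg (fun P => Polynomial.coeff P 0) hfac
    simp only [Polynomial.coeff_C_mul, (coeff_multiset_prod_one_add _).1, mul_one] at hc
    rw [hc]
    exact hfac

/-- Szász's inequality for polynomials without zeros in the upper half-plane. -/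
lemma norm_eval_le_szasz (Q : Polynomial ℂ) (h0 : Q.coeff 0 ≠ 0)
    (hQ : ∀ t : ℂ, 0 < t.im → Q.eval t ≠ 0) (t : ℂ) :
    ‖Q.eval t‖ ≤ ‖Q.coeff 0‖ * Real.exp (‖Q.coeff 1 / Q.coeff 0‖ * ‖t‖ +
      ‖t‖ ^ 2 * (3 * ‖Q.coeff 1 / Q.coeff 0‖ ^ 2 + 2 * ‖Q.coeff 2 / Q.coeff 0‖) / 2) := by
  obtain ⟨s, hs, hfac⟩ := exists_multiset_eq_prod_one_add Q h0 hQ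
  obtain ⟨-, c1, c2⟩ := coeff_multiset_prod_one_add s
  have e1 : Q.coeff 1 / Q.coeff 0 = s.sum := by
    rw [div_eq_iff h0]
    conv_lhs => rw [hfac, Polynomial.coeff_C_mul, c1, mul_comm]
  have e2 : 2 * (Q.coeff 2 / Q.coeff 0) = s.sum ^ 2 - (s.map fun x => x ^ 2).sum := by
    rw [← c2, ← mul_div_assoc, div_eq_iff h0]
    conv_lhs => rw [hfac, Polynomial.coeff_C_mul]
    ring
  have hsq : ‖(s.map fun x => x ^ 2).sum‖ ≤ ‖s.sum‖ ^ 2 + 2 * ‖Q.coeff 2 / Q.coeff 0‖ := by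
    rw [show (s.map fun x => x ^ 2).sum = s.sum ^ 2 - 2 * (Q.coeff 2 / Q.coeff 0) by rw [e2]; ring]
    refine (norm_sub_le _ _).trans_eq ?_
    simp
  have hev : Q.eval t = Q.coeff 0 * (s.map fun x => 1 + x * t).prod := by
    conv_lhs => rw [hfac]
    simp [Polynomial.eval_multiset_prod, Multiset.map_map]
  rw [hev, norm_mul]
  refine mul_le_mul_of_nonneg_left ((norm_multiset_prod_one_add_le s t).trans ?_) (norm_nonneg _)
  rw [Real.exp_le_exp, e1]
  refine add_le_add ((Complex.re_le_norm _).trans (norm_mul_le _ _)) ?_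
  have := multiset_sum_normSq_le s hs
  refine div_le_div_of_nonneg_right (mul_le_mul_of_nonneg_left ?_ (sq_nonneg _)) zero_le_two
  linarith

lemma iteratedDeriv_polynomial_eval (Q : Polynomial ℂ) (k : ℕ) :
    iteratedDeriv k (fun t => Q.eval t) = fun t => (Polynomial.derivative^[k] Q).eval t := by
  induction k with
  | zero => simp
  | succ k ih =>
    rw [iteratedDeriv_succ, ih, Function.iterate_succ_apply']
    funext t
    exact Polynomial.deriv _

lemma norm_coeff_le_of_forall_norm_eval_le (Q : Polynomial ℂ) (r M : ℝ) (hr : 0 < r)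
    (h : ∀ t : ℂ, ‖t‖ = r → ‖Q.eval t‖ ≤ M) (k : ℕ) : ‖Q.coeff k‖ ≤ M / r ^ k := by
  have := Complex.norm_iteratedDeriv_le_of_forall_mem_sphere_norm_le (c := 0) (C := M)
    (f := fun t => Q.eval t) k hr Q.differentiable.diffContOnCl
    fun t ht => h t (by simpa using ht)
  rw [iteratedDeriv_polynomial_eval] at this
  simp only [← Polynomial.coeff_zero_eq_eval_zero, Polynomial.coeff_iterate_derivative, zero_add,
    Nat.descFactorial_self, nsmul_eq_mul, norm_mul, Complex.norm_natCast, mul_div_assoc] at this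
  exact le_of_mul_le_mul_left this (by positivity)

lemma sum_choose_mul_add_mul_pow_of_lt (x h : ℂ) (hh : h ≠ 0) {j n : ℕ} (hj : j < n) :
    ∑ b ∈ Finset.range (n + 1), (-1) ^ (n - b) * (n.choose b : ℂ) * (x + h * b) ^ j = 0 := by
  have := fwdDiff_iter_eq_sum_shift (1 : ℂ) (fun r => r ^ j) n (x / h)
  rw [fwdDiff_iter_pow_eq_zero_of_lt hj] at this
  have h2 := congrArg (fun y => h ^ j * y) this.symm
  simp only [Pi.zero_apply, mul_zero, Finset.mul_sum] at h2
  rw [← h2]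
  refine Finset.sum_congr rfl fun b _ => ?_
  rw [show x + h * b = h * (x / h + b • (1 : ℂ)) by simp; field_simp, mul_pow, zsmul_eq_mul]
  push_cast
  ring

lemma sum_choose_mul_add_mul_pow_self (x h : ℂ) (hh : h ≠ 0) (n : ℕ) :
    ∑ b ∈ Finset.range (n + 1), (-1) ^ (n - b) * (n.choose b : ℂ) * (x + h * b) ^ n =
      h ^ n * n.factorial := by
  have := fwdDiff_iter_eq_sum_shift (1 : ℂ) (fun r => r ^ n) n (x / h)
  rw [fwdDiff_iter_eq_factorial] at this
  have h2 := congrArg (fun y => h ^ n * y) this.symm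
  simp only [Pi.natCast_apply, Finset.mul_sum] at h2
  rw [← h2]
  refine Finset.sum_congr rfl fun b _ => ?_
  rw [show x + h * b = h * (x / h + b • (1 : ℂ)) by simp; field_simp, mul_pow, zsmul_eq_mul]
  push_cast
  ring

/-- The value at `v` of the homogeneous part of degree `j` of `∑ x_γ v^γ`. -/
noncomputable def homogPart {τ : Type*} [Fintype τ] [DecidableEq τ] (j : ℕ) (x : (τ →₀ ℕ) → ℂ)
    (v : τ → ℂ) : ℂ :=
  ∑ d ∈ Finset.univ.finsuppAntidiag j, x d * ∏ i, v i ^ d i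

lemma coeff_lineRestrict_zero {τ : Type*} [Fintype τ] [DecidableEq τ] (f : MvPolynomial τ ℂ)
    (v : τ → ℂ) (j : ℕ) :
    (lineRestrict 0 v f).coeff j = homogPart j (fun d => f.coeff d) v := by
  rw [lineRestrict, aeval_def, eval₂_eq', Polynomial.finsetSum_coeff, homogPart]
  have h1 : ∀ d : τ →₀ ℕ, (algebraMap ℂ (Polynomial ℂ) (coeff d f) *
      ∏ i, (Polynomial.C ((0 : τ → ℂ) i) + Polynomial.C (v i) * Polynomial.X) ^ d i).coeff j =
      if ∑ i, d i = j then f.coeff d * ∏ i, v i ^ d i else 0 := by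
    intro d
    simp only [Pi.zero_apply, map_zero, zero_add, mul_pow, Finset.prod_mul_distrib,
      Finset.prod_pow_eq_pow_sum, ← Polynomial.C_pow, ← map_prod, Polynomial.algebraMap_eq]
    rw [Polynomial.coeff_C_mul, Polynomial.coeff_C_mul_X_pow]
    split_ifs <;> simp_all
  simp only [h1]
  rw [← Finset.sum_filter]
  refine Finset.sum_subset_zero_on_sdiff (fun d hd => ?_) (fun d hd => ?_) fun _ _ => rfl
  · simpa [Finset.mem_finsuppAntidiag] using (Finset.mem_filter.mp hd).2
  · simp only [Finset.mem_sdiff, Finset.mem_finsuppAntidiag, Finset.mem_filter, mem_support_iff,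
      Finset.subset_univ, and_true, not_and] at hd
    have : coeff d f = 0 := by
      by_contra h
      exact hd.2 h hd.1
    simp [this]

lemma norm_coeff_le_of_homogPart_le {τ : Type*} [Fintype τ] [DecidableEq τ] (x : (τ →₀ ℕ) → ℂ)
    (γ : τ →₀ ℕ) (a : τ → ℂ) (h M : ℝ) (hh : 0 < h)
    (hM : ∀ β : τ → ℕ, (∀ i, β i ≤ γ i) →
      ‖homogPart (∑ i, γ i) x (fun i => a i + h * β i)‖ ≤ M) :
    ‖x γ‖ * (h ^ (∑ i, γ i) * ∏ i, ((γ i).factorial : ℝ)) ≤ 2 ^ (∑ i, γ i) * M := by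
  have hc : (h : ℂ) ≠ 0 := by exact_mod_cast hh.ne'
  have key : ∑ β ∈ Fintype.piFinset fun i => Finset.range (γ i + 1),
      (∏ i, (-1) ^ (γ i - β i) * ((γ i).choose (β i) : ℂ)) *
        homogPart (∑ i, γ i) x (fun i => a i + h * β i) =
      x γ * ((h : ℂ) ^ (∑ i, γ i) * ∏ i, ((γ i).factorial : ℂ)) := by
    simp only [homogPart, Finset.mul_sum]
    rw [Finset.sum_comm, Finset.sum_eq_single γ]
    · simp only [mul_left_comm _ (x γ), ← Finset.mul_sum, ← Finset.prod_mul_distrib]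
      rw [← Finset.prod_univ_sum (fun i => Finset.range (γ i + 1)) (fun i b =>
        (-1) ^ (γ i - b) * ((γ i).choose b : ℂ) * (a i + h * b) ^ γ i)]
      simp only [sum_choose_mul_add_mul_pow_self _ _ hc, Finset.prod_mul_distrib,
        Finset.prod_pow_eq_pow_sum]
    · intro d hd hne
      simp only [mul_left_comm _ (x d), ← Finset.mul_sum, ← Finset.prod_mul_distrib]
      rw [← Finset.prod_univ_sum (fun i => Finset.range (γ i + 1)) (fun i b =>
        (-1) ^ (γ i - b) * ((γ i).choose b : ℂ) * (a i + h * b) ^ d i)]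
      obtain ⟨i, hi⟩ : ∃ i, d i < γ i := by
        by_contra! hle
        rw [Finset.mem_finsuppAntidiag] at hd
        refine hne (Finsupp.ext fun i => ?_)
        exact ((Finset.sum_eq_sum_iff_of_le fun i _ => hle i).mp hd.1.symm i
          (Finset.mem_univ i)).symm
      rw [Finset.prod_eq_zero (Finset.mem_univ i)
        (sum_choose_mul_add_mul_pow_of_lt _ _ hc hi), mul_zero]
    · intro hγ
      exact (hγ (by simp [Finset.mem_finsuppAntidiag])).elim
  have hn := congrArg norm key
  have hr : ‖x γ * ((h : ℂ) ^ (∑ i, γ i) * ∏ i, ((γ i).factorial : ℂ))‖ =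
      ‖x γ‖ * (h ^ (∑ i, γ i) * ∏ i, ((γ i).factorial : ℝ)) := by
    simp [norm_prod, abs_of_pos hh]
  rw [← hr, ← hn]
  refine (norm_sum_le _ _).trans ?_
  have h2 : (2 : ℝ) ^ (∑ i, γ i) = ∑ β ∈ Fintype.piFinset fun i => Finset.range (γ i + 1),
      ∏ i, ((γ i).choose (β i) : ℝ) := by
    rw [← Finset.prod_univ_sum (fun i => Finset.range (γ i + 1)) (fun i b =>
      ((γ i).choose b : ℝ)), ← Finset.prod_pow_eq_pow_sum]
    refine Finset.prod_congr rfl fun i _ => ?_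
    exact_mod_cast (Nat.sum_range_choose (γ i)).symm
  rw [h2, Finset.sum_mul]
  refine Finset.sum_le_sum fun β hβ => ?_
  rw [norm_mul]
  refine mul_le_mul (le_of_eq ?_) (hM β fun i => ?_) (norm_nonneg _)
    (Finset.prod_nonneg fun i _ => by positivity)
  · simp [norm_prod]
  · exact Nat.lt_succ_iff.mp (Finset.mem_range.mp (Fintype.mem_piFinset.mp hβ i))

lemma IsStable.norm_homogPart_le {τ : Type*} [Fintype τ] [DecidableEq τ] {f : MvPolynomial τ ℂ}
    (hf : IsStable f) {k₀ : ℕ} (hk₀ : ∀ γ : τ →₀ ℕ, ∑ i, γ i < k₀ → f.coeff γ = 0)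
    (v : τ → ℝ) (hv : ∀ i, 0 < v i) {A b ρ : ℝ} (hb : 0 < b) (hρ : 0 < ρ)
    (h0 : b ≤ ‖homogPart k₀ (fun d => f.coeff d) (fun i => (v i : ℂ))‖)
    (hA : ∀ k ≤ 2, ‖homogPart (k₀ + k) (fun d => f.coeff d) (fun i => (v i : ℂ))‖ ≤ A) (k : ℕ) :
    ‖homogPart (k₀ + k) (fun d => f.coeff d) (fun i => (v i : ℂ))‖ ≤
      A * Real.exp (A / b * ρ + ρ ^ 2 * (3 * (A / b) ^ 2 + 2 * (A / b)) / 2) / ρ ^ k := by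
  simp only [← coeff_lineRestrict_zero] at *
  set q := lineRestrict 0 (fun i => (v i : ℂ)) f with hq
  obtain ⟨Q, hQ⟩ : Polynomial.X ^ k₀ ∣ q := by
    rw [Polynomial.X_pow_dvd_iff]
    intro d hd
    rw [hq, coeff_lineRestrict_zero, homogPart]
    refine Finset.sum_eq_zero fun γ hγ => ?_
    rw [hk₀ γ (by rw [(Finset.mem_finsuppAntidiag.mp hγ).1]; exact hd), zero_mul]
  have hcoeff : ∀ k, q.coeff (k₀ + k) = Q.coeff k := fun k => by
    rw [hQ, add_comm, Polynomial.coeff_X_pow_mul]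
  have hc0 : q.coeff k₀ = Q.coeff 0 := hcoeff 0
  simp only [hcoeff] at hA ⊢
  rw [hc0] at h0
  have hQ0 : Q.coeff 0 ≠ 0 := norm_pos_iff.mp (hb.trans_le h0)
  have hQs : ∀ t : ℂ, 0 < t.im → Q.eval t ≠ 0 := by
    intro t ht h
    refine hf (fun i => v i * t) (fun i => ?_) ?_
    · rw [Complex.im_ofReal_mul]
      exact mul_pos (hv i) ht
    · have := eval_lineRestrict 0 (fun i => (v i : ℂ)) f t
      simp only [Pi.zero_apply, zero_add] at this
      rw [← this, ← hq, hQ, Polynomial.eval_mul, h, mul_zero]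
  have hA0 : 0 ≤ A := (norm_nonneg _).trans (hA 0 (by norm_num))
  have hdiv : ∀ k ≤ 2, ‖Q.coeff k / Q.coeff 0‖ ≤ A / b := fun k hk => by
    rw [norm_div]
    exact div_le_div₀ hA0 (hA k hk) hb h0
  have h1 := hdiv 1 (by norm_num)
  have h2 := hdiv 2 le_rfl
  refine norm_coeff_le_of_forall_norm_eval_le Q ρ _ hρ (fun t ht => ?_) k
  refine (norm_eval_le_szasz Q hQ0 hQs t).trans ?_
  rw [ht]
  gcongr
  exact hA 0 (by norm_num)

lemma continuous_homogPart {τ : Type*} [Fintype τ] [DecidableEq τ] (j : ℕ) :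
    Continuous fun p : ((τ →₀ ℕ) → ℂ) × (τ → ℂ) => homogPart j p.1 p.2 := by
  unfold homogPart
  fun_prop

lemma exists_pos_homogPart_ne_zero {τ : Type*} [Fintype τ] [DecidableEq τ] (c : (τ →₀ ℕ) → ℂ)
    (γ : τ →₀ ℕ) (hγ : c γ ≠ 0) :
    ∃ a : τ → ℝ, (∀ i, 0 < a i) ∧ homogPart (∑ i, γ i) c (fun i => (a i : ℂ)) ≠ 0 := by
  by_contra! h
  set P : MvPolynomial τ ℂ := ∑ d ∈ Finset.univ.finsuppAntidiag (∑ i, γ i), monomial d (c d)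
    with hP
  have hP0 : P = 0 := by
    refine funext_set (fun _ => Complex.ofReal '' Set.Ioi 0) (fun _ => ?_) fun x hx => ?_
    · exact (Set.Ioi_infinite (0 : ℝ)).image Complex.ofReal_injective.injOn
    · choose a ha hax using fun i => hx i trivial
      have := h a ha
      simp only [hax] at this
      rw [map_zero, ← this, hP, map_sum, homogPart]
      refine Finset.sum_congr rfl fun d _ => ?_
      rw [eval_monomial, Finsupp.prod_fintype _ _ fun i => pow_zero _]
  refine hγ ?_
  have h1 := congrArg (coeff γ) hP0
  rw [hP, coeff_sum, coeff_zero] at h1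
  simp only [coeff_monomial] at h1
  rw [Finset.sum_ite_eq' (Finset.univ.finsuppAntidiag (∑ i, γ i)) γ c] at h1
  simpa [Finset.mem_finsuppAntidiag] using h1

lemma exists_homogPart_bounds {τ : Type*} [Fintype τ] [DecidableEq τ] (c : (τ →₀ ℕ) → ℂ)
    (k₀ : ℕ) (a : τ → ℝ) (ha : homogPart k₀ c (fun i => (a i : ℂ)) ≠ 0) :
    ∃ A b δ : ℝ, 0 < b ∧ 0 < δ ∧ ∀ x : ℕ → (τ →₀ ℕ) → ℂ,
      (∀ γ, Filter.Tendsto (fun m => x m γ) Filter.atTop (nhds (c γ))) →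
      ∀ᶠ m in Filter.atTop, ∀ v : τ → ℝ, (∀ i, a i ≤ v i ∧ v i ≤ a i + δ) →
        b ≤ ‖homogPart k₀ (x m) (fun i => (v i : ℂ))‖ ∧
        ∀ k ≤ 2, ‖homogPart (k₀ + k) (x m) (fun i => (v i : ℂ))‖ ≤ A := by
  set ac : τ → ℂ := fun i => (a i : ℂ)
  set b := ‖homogPart k₀ c ac‖ / 2
  set A := ∑ k ∈ Finset.range 3, ‖homogPart (k₀ + k) c ac‖ + 1
  have hb : 0 < b := half_pos (norm_pos_iff.mpr ha)
  have e1 : ∀ᶠ p : ((τ →₀ ℕ) → ℂ) × (τ → ℂ) in nhds (c, ac), b < ‖homogPart k₀ p.1 p.2‖ :=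
    (continuous_homogPart k₀).norm.continuousAt.eventually_const_lt
      (half_lt_self (norm_pos_iff.mpr ha))
  have e2 : ∀ᶠ p : ((τ →₀ ℕ) → ℂ) × (τ → ℂ) in nhds (c, ac), ∀ k ∈ Finset.range 3,
      ‖homogPart (k₀ + k) p.1 p.2‖ < A := by
    rw [Filter.eventually_all_finset]
    intro k hk
    refine (continuous_homogPart (k₀ + k)).norm.continuousAt.eventually_lt_const ?_
    have := Finset.single_le_sum (f := fun k => ‖homogPart (k₀ + k) c ac‖)
      (fun _ _ => norm_nonneg _) hk
    exact lt_of_le_of_lt this (lt_add_one _)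
  obtain ⟨p1, hp1, p2, hp2, h12⟩ := Filter.eventually_prod_iff.mp
    (nhds_prod_eq (x := c) (y := ac) ▸ e1.and e2)
  obtain ⟨δ, hδ, hball⟩ := Metric.eventually_nhds_iff.mp hp2
  refine ⟨A, b, δ / 2, hb, half_pos hδ, fun x hx => ?_⟩
  filter_upwards [(tendsto_pi_nhds.mpr hx).eventually hp1] with m hm v hv
  have hv2 : p2 fun i => (v i : ℂ) := by
    refine hball ((dist_pi_lt_iff hδ).mpr fun i => ?_)
    rw [Complex.dist_eq, ← Complex.ofReal_sub, Complex.norm_real, Real.norm_eq_abs,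
      abs_of_nonneg (by linarith [hv i])]
    linarith [hv i]
  have := h12 hm hv2
  exact ⟨this.1.le, fun k hk => (this.2 k (by simp; omega)).le⟩

lemma pow_sum_le_exp_pow_mul_prod_factorial {τ : Type*} [Fintype τ] (γ : τ → ℕ) (x : ℝ)
    (hx : 0 ≤ x) :
    x ^ (∑ i, γ i) ≤ Real.exp x ^ Fintype.card τ * ∏ i, ((γ i).factorial : ℝ) := by
  rw [← Finset.prod_pow_eq_pow_sum, Fintype.card, ← Finset.prod_const, ← Finset.prod_mul_distrib]
  refine Finset.prod_le_prod (fun i _ => pow_nonneg hx _) fun i _ => ?_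
  have := Real.pow_div_factorial_le_exp x hx (γ i)
  rwa [div_le_iff₀ (by positivity)] at this

/-- Coefficients of a coefficientwise convergent sequence of stable polynomials decay faster than
any geometric sequence, uniformly along the sequence. -/
lemma exists_norm_coeff_le_of_tendsto {τ : Type*} [Fintype τ] [DecidableEq τ]
    (f : ℕ → MvPolynomial τ ℂ) (hf : ∀ m, IsStable (f m)) (c : (τ →₀ ℕ) → ℂ)
    (hc : ∀ γ, Filter.Tendsto (fun m => (f m).coeff γ) Filter.atTop (nhds (c γ)))
    (hzero : ∀ γ, c γ = 0 → ∀ m, (f m).coeff γ = 0) (hne : ∃ γ, c γ ≠ 0) (L : ℝ) (hL : 0 < L) :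
    ∃ C : ℝ, ∀ᶠ m in Filter.atTop, ∀ γ, ‖(f m).coeff γ‖ ≤ C / L ^ (∑ i, γ i) := by
  obtain ⟨k₀, ⟨γ₀, hγ₀, hk₀⟩, hmin⟩ : ∃ k₀, (∃ γ, c γ ≠ 0 ∧ ∑ i, γ i = k₀) ∧
      ∀ γ, ∑ i, γ i < k₀ → c γ = 0 := by
    classical
    have hex : ∃ k, ∃ γ, c γ ≠ 0 ∧ ∑ i, γ i = k := by
      obtain ⟨γ, hγ⟩ := hne
      exact ⟨_, γ, hγ, rfl⟩
    refine ⟨Nat.find hex, Nat.find_spec hex, fun γ hγ => ?_⟩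
    by_contra h
    exact Nat.find_min hex hγ ⟨γ, h, rfl⟩
  obtain ⟨a, ha, ha0⟩ := exists_pos_homogPart_ne_zero c γ₀ hγ₀
  rw [hk₀] at ha0
  obtain ⟨A, b, δ, hb, hδ, hbd⟩ := exists_homogPart_bounds c k₀ a ha0
  set E : ℝ := Real.exp 1 ^ Fintype.card τ with hE
  have hEpos : 0 < E := by positivity
  set ρ : ℝ := 2 * E * L / δ with hρdef
  have hρ : 0 < ρ := by positivity
  set M := A * Real.exp (A / b * ρ + ρ ^ 2 * (3 * (A / b) ^ 2 + 2 * (A / b)) / 2) with hM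
  refine ⟨M * ρ ^ k₀ * E, ?_⟩
  filter_upwards [hbd (fun m γ => (f m).coeff γ) hc] with m hm γ
  have hA0 : 0 ≤ A := by
    have := (hm a fun i => ⟨le_rfl, by linarith⟩).2 0 (by norm_num)
    exact (norm_nonneg _).trans this
  have hM0 : 0 ≤ M := by positivity
  by_cases hk : ∑ i, γ i < k₀
  · rw [hzero γ (hmin γ hk), norm_zero]
    positivity
  obtain ⟨k, hk⟩ := Nat.exists_eq_add_of_le (not_lt.mp hk)
  set K := ∑ i, γ i with hK
  have hh : 0 < δ / (K + 1 : ℝ) := by positivity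
  have hpt := norm_coeff_le_of_homogPart_le (fun d => (f m).coeff d) γ (fun i => (a i : ℂ))
    (δ / (K + 1)) (M / ρ ^ k) hh fun β hβ => by
      have hv : ∀ i, a i ≤ a i + δ / (K + 1) * β i ∧ a i + δ / (K + 1) * β i ≤ a i + δ := by
        intro i
        refine ⟨le_add_of_nonneg_right (by positivity), ?_⟩
        have h1 : (β i : ℝ) ≤ K + 1 := by
          have : β i ≤ K := (hβ i).trans (Finset.single_le_sum (f := fun i => γ i)
            (fun _ _ => Nat.zero_le _) (Finset.mem_univ i))
          have : (β i : ℝ) ≤ K := by exact_mod_cast this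
          linarith
        rw [div_mul_eq_mul_div]
        have : δ * β i / (K + 1 : ℝ) ≤ δ := by
          rw [div_le_iff₀ (by positivity)]
          exact mul_le_mul_of_nonneg_left h1 hδ.le
        linarith
      have h2 := hm _ hv
      have h3 := (hf m).norm_homogPart_le (fun γ hγ => hzero γ (hmin γ hγ) m)
        (fun i => a i + δ / (K + 1) * β i) (fun i => (ha i).trans_le (hv i).1) hb hρ h2.1 h2.2 k
      rw [← hk] at h3
      push_cast at h3 ⊢
      exact h3
  have hfac := pow_sum_le_exp_pow_mul_prod_factorial γ ((K : ℝ) + 1) (by positivity)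
  have hexp : Real.exp ((K : ℝ) + 1) ^ Fintype.card τ = E ^ K * E := by
    rw [hE, ← pow_succ, ← pow_mul, ← Real.exp_nat_mul, ← Real.exp_nat_mul]
    congr 1
    push_cast
    ring
  rw [hexp, ← hK] at hfac
  set Φ := ∏ i, ((γ i).factorial : ℝ) with hΦ
  have hΦpos : 0 < Φ := Finset.prod_pos fun i _ => by positivity
  rw [← hK, div_pow] at hpt
  have hρk : ρ ^ K = ρ ^ k₀ * ρ ^ k := by rw [hk, pow_add]
  have h4 : ‖coeff γ (f m)‖ * δ ^ K * Φ ≤ 2 ^ K * (M / ρ ^ k) * (E ^ K * E * Φ) := by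
    calc ‖coeff γ (f m)‖ * δ ^ K * Φ
        = ‖coeff γ (f m)‖ * (δ ^ K / (K + 1) ^ K * Φ) * ((K : ℝ) + 1) ^ K := by
          field_simp
      _ ≤ 2 ^ K * (M / ρ ^ k) * ((K : ℝ) + 1) ^ K :=
          mul_le_mul_of_nonneg_right hpt (by positivity)
      _ ≤ _ := mul_le_mul_of_nonneg_left hfac (by positivity)
  have h5 : ‖coeff γ (f m)‖ * δ ^ K ≤ 2 ^ K * (M / ρ ^ k) * (E ^ K * E) := by
    refine le_of_mul_le_mul_right ?_ hΦpos
    linarith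
  rw [le_div_iff₀ (by positivity)]
  have h6 : δ ^ K * ρ ^ K = 2 ^ K * E ^ K * L ^ K := by
    rw [← mul_pow, hρdef, mul_div_cancel₀ _ hδ.ne', mul_pow, mul_pow]
  have h7 : ‖coeff γ (f m)‖ * (δ ^ K * ρ ^ K) ≤ M * ρ ^ k₀ * E * (2 ^ K * E ^ K) := by
    calc ‖coeff γ (f m)‖ * (δ ^ K * ρ ^ K) = ‖coeff γ (f m)‖ * δ ^ K * ρ ^ K := by ring
      _ ≤ 2 ^ K * (M / ρ ^ k) * (E ^ K * E) * ρ ^ K :=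
          mul_le_mul_of_nonneg_right h5 (by positivity)
      _ = _ := by rw [hρk]; field_simp
  rw [h6] at h7
  refine le_of_mul_le_mul_right ?_ (show 0 < 2 ^ K * E ^ K by positivity)
  linarith

lemma summable_pow_sum {τ : Type*} [Fintype τ] [DecidableEq τ] (r : ℝ) (h0 : 0 ≤ r) (h1 : r < 1) :
    Summable fun γ : τ →₀ ℕ => r ^ (∑ i, γ i) := by
  have h : Summable fun γ : τ → ℕ => r ^ (∑ i, γ i) := by
    refine summable_of_sum_le (c := ∏ _i : τ, (1 - r)⁻¹) (fun γ => by positivity) fun S => ?_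
    have hS : S ⊆ Fintype.piFinset fun _ => Finset.range (S.sup (fun γ => ∑ i, γ i) + 1) := by
      intro γ hγ
      rw [Fintype.mem_piFinset]
      intro i
      rw [Finset.mem_range, Nat.lt_succ_iff]
      exact (Finset.single_le_sum (f := fun i => γ i) (fun _ _ => Nat.zero_le _)
        (Finset.mem_univ i)).trans (Finset.le_sup (f := fun γ : τ → ℕ => ∑ i, γ i) hγ)
    refine (Finset.sum_le_sum_of_subset_of_nonneg hS fun _ _ _ => by positivity).trans ?_
    simp only [← Finset.prod_pow_eq_pow_sum]
    rw [← Finset.prod_univ_sum (fun _ => Finset.range _) (fun _ b => r ^ b)]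
    refine Finset.prod_le_prod (fun i _ => Finset.sum_nonneg fun _ _ => by positivity) fun i _ => ?_
    rw [← tsum_geometric_of_lt_one h0 h1]
    exact (summable_geometric_of_lt_one h0 h1).sum_le_tsum _ fun _ _ => by positivity
  exact h.comp_injective (DFunLike.coe_injective (F := τ →₀ ℕ))

lemma norm_monomial_le {τ : Type*} [Fintype τ] (z : τ → ℂ) (R : ℝ) (hz : ∀ i, ‖z i‖ ≤ R)
    (γ : τ →₀ ℕ) : ‖∏ i, z i ^ γ i‖ ≤ R ^ (∑ i, γ i) := by
  rw [norm_prod, ← Finset.prod_pow_eq_pow_sum]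
  refine Finset.prod_le_prod (fun i _ => norm_nonneg _) fun i _ => ?_
  rw [norm_pow]
  exact pow_le_pow_left₀ (norm_nonneg _) (hz i) _

lemma hasSum_coeff_eval {τ : Type*} [Fintype τ] (p : MvPolynomial τ ℂ) (z : τ → ℂ) :
    HasSum (fun γ => p.coeff γ * ∏ i, z i ^ γ i) (eval z p) := by
  rw [eval_eq']
  refine hasSum_sum_of_ne_finset_zero fun γ hγ => ?_
  rw [notMem_support_iff.mp hγ, zero_mul]

/-- A coefficientwise convergent sequence of polynomials whose coefficients decay uniformly faster
than any geometric sequence converges to an entire function. -/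
lemma summable_and_tendstoUniformlyOn_of_coeff {τ : Type*} [Fintype τ] [DecidableEq τ]
    (f : ℕ → MvPolynomial τ ℂ) (c : (τ →₀ ℕ) → ℂ)
    (hc : ∀ γ, Filter.Tendsto (fun m => (f m).coeff γ) Filter.atTop (nhds (c γ)))
    (hbd : ∀ L : ℝ, 0 < L →
      ∃ C : ℝ, ∀ᶠ m in Filter.atTop, ∀ γ, ‖(f m).coeff γ‖ ≤ C / L ^ (∑ i, γ i)) :
    (∀ z : τ → ℂ, Summable fun γ => c γ * ∏ i, z i ^ γ i) ∧
    ∀ K : Set (τ → ℂ), IsCompact K → TendstoUniformlyOn (fun m z => eval z (f m))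
      (fun z => ∑' γ, c γ * ∏ i, z i ^ γ i) Filter.atTop K := by
  have hbd' : ∀ R : ℝ, 0 < R → ∃ C : ℝ, (∀ γ, ‖c γ‖ * R ^ (∑ i, γ i) ≤ C * (1 / 2) ^ (∑ i, γ i)) ∧
      ∀ᶠ m in Filter.atTop, ∀ γ,
        ‖(f m).coeff γ‖ * R ^ (∑ i, γ i) ≤ C * (1 / 2) ^ (∑ i, γ i) := by
    intro R hR
    obtain ⟨C, hC⟩ := hbd (2 * R) (by positivity)
    have h2 : ∀ᶠ m in Filter.atTop, ∀ γ,
        ‖(f m).coeff γ‖ * R ^ (∑ i, γ i) ≤ C * (1 / 2) ^ (∑ i, γ i) := by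
      filter_upwards [hC] with m hm γ
      refine (mul_le_mul_of_nonneg_right (hm γ) (by positivity)).trans_eq ?_
      rw [mul_pow, one_div, inv_pow]
      field_simp
    refine ⟨C, fun γ => ?_, h2⟩
    exact le_of_tendsto ((hc γ).norm.mul_const _) (h2.mono fun m hm => hm γ)
  have hgeo : Summable fun γ : τ →₀ ℕ => (1 / 2 : ℝ) ^ (∑ i, γ i) :=
    summable_pow_sum _ (by norm_num) (by norm_num)
  have hsum : ∀ z : τ → ℂ, Summable fun γ => c γ * ∏ i, z i ^ γ i := by
    intro z
    obtain ⟨C, hC, -⟩ := hbd' (‖z‖ + 1) (by positivity)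
    refine Summable.of_norm_bounded (hgeo.mul_left C) fun γ => ?_
    rw [norm_mul]
    refine le_trans (mul_le_mul_of_nonneg_left (norm_monomial_le z (‖z‖ + 1) (fun i => ?_) γ)
      (norm_nonneg _)) (hC γ)
    exact (norm_le_pi_norm z i).trans (by linarith)
  refine ⟨hsum, fun K hK => ?_⟩
  obtain ⟨R, hR, hKR⟩ := hK.isBounded.exists_pos_norm_le
  obtain ⟨C, hC, hCm⟩ := hbd' R hR
  have hle : ∀ᶠ m in Filter.atTop, ∀ γ, ‖‖(f m).coeff γ - c γ‖ * R ^ (∑ i, γ i)‖ ≤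
      2 * C * (1 / 2) ^ (∑ i, γ i) := by
    filter_upwards [hCm] with m hm γ
    rw [norm_mul, norm_norm, Real.norm_of_nonneg (by positivity : 0 ≤ R ^ (∑ i, γ i))]
    have h1 := mul_le_mul_of_nonneg_right (norm_sub_le ((f m).coeff γ) (c γ))
      (by positivity : 0 ≤ R ^ (∑ i, γ i))
    linarith [hm γ, hC γ]
  have hD := tendsto_tsum_of_dominated_convergence (hgeo.mul_left (2 * C))
    (fun γ => (((hc γ).sub_const (c γ)).norm.mul_const (R ^ (∑ i, γ i)))) hle
  simp only [sub_self, norm_zero, zero_mul, tsum_zero] at hD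
  rw [Metric.tendstoUniformlyOn_iff]
  intro ε hε
  filter_upwards [hD.eventually_lt_const hε, hle] with m hm hlem z hz
  refine lt_of_le_of_lt ?_ hm
  have hs : Summable fun γ => ‖(f m).coeff γ - c γ‖ * R ^ (∑ i, γ i) :=
    Summable.of_norm_bounded (hgeo.mul_left (2 * C)) hlem
  rw [dist_comm, dist_eq_norm]
  have hsub := (hasSum_coeff_eval (f m) z).sub (hsum z).hasSum
  rw [← hsub.tsum_eq]
  refine tsum_of_norm_bounded hs.hasSum fun γ => ?_
  rw [← sub_mul, norm_mul]
  exact mul_le_mul_of_nonneg_left (norm_monomial_le z R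
    (fun i => (norm_le_pi_norm z i).trans (hKR z hz)) γ) (norm_nonneg _)

lemma one_sub_mul_lower_bound (c x : ℂ) (hc : 0 < c.im) (hx : 0 < x.im) :
    1 + ‖x‖ ≤ (‖c‖ + 1) / c.im * ‖1 - c * x‖ := by
  have h1 : c.im ≤ ‖c‖ * ‖1 - c * x‖ := by
    have h : ((starRingEnd ℂ) c * (1 - c * x)).im = -(c.im + Complex.normSq c * x.im) := by
      simp [Complex.normSq_apply]
      ring
    have h2 := Complex.abs_im_le_norm ((starRingEnd ℂ) c * (1 - c * x))
    rw [h, norm_mul, Complex.norm_conj, abs_neg] at h2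
    exact (le_add_of_nonneg_right (mul_nonneg (Complex.normSq_nonneg c) hx.le)).trans
      ((le_abs_self _).trans h2)
  have h2 : ‖x‖ * c.im ≤ ‖1 - c * x‖ := by
    have h : ((starRingEnd ℂ) x * (1 - c * x)).im = -(x.im + Complex.normSq x * c.im) := by
      simp [Complex.normSq_apply]
      ring
    have h2 := Complex.abs_im_le_norm ((starRingEnd ℂ) x * (1 - c * x))
    rw [h, norm_mul, Complex.norm_conj, abs_neg, ← Complex.sq_norm] at h2
    have hx0 : 0 < ‖x‖ := norm_pos_iff.mpr fun h => by simp [h] at hx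
    refine le_of_mul_le_mul_left ?_ hx0
    have := (le_abs_self _).trans h2
    nlinarith
  rw [div_mul_eq_mul_div, le_div_iff₀ hc]
  linarith

/-- The polynomial `∏ᵢ (1 - cᵢ xᵢ)^m`. -/
noncomputable def linProd {ι : Type*} [Fintype ι] (m : ℕ) (c : ι → ℂ) : MvPolynomial ι ℂ :=
  ∏ i, (1 - C (c i) * X i) ^ m

lemma eval_linProd {ι : Type*} [Fintype ι] (m : ℕ) (c x : ι → ℂ) :
    eval x (linProd m c) = ∏ i, (1 - c i * x i) ^ m := by
  simp [linProd]

lemma isStable_linProd {ι : Type*} [Fintype ι] (m : ℕ) (c : ι → ℂ) (hc : ∀ i, 0 < (c i).im) :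
    IsStable (linProd m c) := by
  intro x hx
  rw [eval_linProd]
  refine Finset.prod_ne_zero_iff.mpr fun i _ => pow_ne_zero _ fun h => ?_
  have := one_sub_mul_lower_bound (c i) (x i) (hc i) (hx i)
  rw [h, norm_zero, mul_zero] at this
  linarith [norm_nonneg (x i)]

lemma exists_norm_eval_le_linProd {ι : Type*} [Fintype ι] (m : ℕ) (c : ι → ℂ)
    (hc : ∀ i, 0 < (c i).im) (f : MvPolynomial ι ℂ) (hf : ∀ i, degreeOf i f ≤ m) :
    ∃ K : ℝ, 0 ≤ K ∧ ∀ x : ι → ℂ, (∀ i, 0 < (x i).im) →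
      ‖eval x f‖ ≤ K * ‖eval x (linProd m c)‖ := by
  have hK : ∀ i, 0 ≤ (‖c i‖ + 1) / (c i).im := fun i =>
    div_nonneg (by positivity) (hc i).le
  refine ⟨(∑ γ ∈ f.support, ‖coeff γ f‖) * ∏ i, ((‖c i‖ + 1) / (c i).im) ^ m,
    mul_nonneg (Finset.sum_nonneg fun _ _ => norm_nonneg _)
      (Finset.prod_nonneg fun i _ => pow_nonneg (hK i) _), fun x hx => ?_⟩
  rw [eval_eq', Finset.sum_mul, Finset.sum_mul]
  refine norm_sum_le_of_le _ fun γ hγ => ?_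
  rw [norm_mul, mul_assoc, eval_linProd, norm_prod, norm_prod, ← Finset.prod_mul_distrib]
  refine mul_le_mul_of_nonneg_left (Finset.prod_le_prod (fun i _ => norm_nonneg _) fun i _ => ?_)
    (norm_nonneg _)
  rw [norm_pow, norm_pow, ← mul_pow]
  calc ‖x i‖ ^ γ i ≤ (1 + ‖x i‖) ^ γ i := pow_le_pow_left₀ (norm_nonneg _) (by linarith) _
    _ ≤ (1 + ‖x i‖) ^ m := pow_le_pow_right₀ (by linarith [norm_nonneg (x i)])
        ((monomial_le_degreeOf i hγ).trans (hf i))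
    _ ≤ _ := pow_le_pow_left₀ (by positivity)
        (one_sub_mul_lower_bound (c i) (x i) (hc i) (hx i)) _

lemma isStable_map_linProd {ι : Type*} [Fintype ι]
    (T : MvPolynomial ι ℂ →ₗ[ℂ] MvPolynomial ι ℂ)
    (hT : ∀ f, IsStable f → IsStable (T f) ∨ T f = 0) (f₀ : MvPolynomial ι ℂ)
    (hf₀ : ¬ IsStable (T f₀)) (hf₀' : T f₀ ≠ 0) (m : ℕ) (hm : ∀ i, degreeOf i f₀ ≤ m)
    (c : ι → ℂ) (hc : ∀ i, 0 < (c i).im) : IsStable (T (linProd m c)) := by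
  refine (hT _ (isStable_linProd m c hc)).resolve_right fun h0 => ?_
  obtain ⟨K, hK0, hK⟩ := exists_norm_eval_le_linProd m c hc f₀ hm
  have hε : ((K : ℂ) + 1)⁻¹ ≠ 0 := by
    refine inv_ne_zero ?_
    exact_mod_cast (by positivity : K + 1 ≠ 0)
  have hst : IsStable (linProd m c + ((K : ℂ) + 1)⁻¹ • f₀) := by
    intro x hx h
    have hpos : 0 < ‖eval x (linProd m c)‖ := norm_pos_iff.mpr (isStable_linProd m c hc x hx)
    rw [map_add, smul_eval] at h
    have h1 := congrArg norm (eq_neg_of_add_eq_zero_left h)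
    rw [norm_neg, norm_mul, norm_inv, ← Complex.ofReal_one, ← Complex.ofReal_add,
      Complex.norm_real, Real.norm_of_nonneg (by positivity), inv_mul_eq_div,
      eq_div_iff (by positivity)] at h1
    linarith [hK x hx]
  have h1 := hT _ hst
  rw [map_add, h0, zero_add, map_smul] at h1
  rcases h1 with h1 | h1
  · exact hf₀ fun z hz h => h1 z hz (by rw [smul_eval, h, mul_zero])
  · exact hf₀' ((smul_eq_zero.mp h1).resolve_left hε)

/-- The coefficients of the transcendental symbol. -/
noncomputable def symbolCoeff {n : ℕ} (T : MvPolynomial (Fin n) ℂ →ₗ[ℂ] MvPolynomial (Fin n) ℂ)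
    (γ : Fin n ⊕ Fin n →₀ ℕ) : ℂ :=
  (∏ i, (-1) ^ γ (Sum.inr i) / ((γ (Sum.inr i)).factorial : ℂ)) *
    coeff (Finsupp.sumFinsuppEquivProdFinsupp γ).1
      (T (monomial (Finsupp.sumFinsuppEquivProdFinsupp γ).2 1))

/-- The polynomial `T(∏ᵢ (1 - zᵢ wᵢ / m)^m)`, where `T` acts on the variables `zᵢ`. -/
noncomputable def symbolApprox {n : ℕ} (T : MvPolynomial (Fin n) ℂ →ₗ[ℂ] MvPolynomial (Fin n) ℂ)
    (m : ℕ) : MvPolynomial (Fin n ⊕ Fin n) ℂ :=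
  ∑ α ∈ Fintype.piFinset fun _ : Fin n => Finset.range (m + 1),
    (∏ i, (m.choose (α i) : ℂ) * (-1 / m) ^ α i) •
      (rename Sum.inl (T (monomial (Finsupp.equivFunOnFinite.symm α) 1)) *
        monomial (Finsupp.mapDomain Sum.inr (Finsupp.equivFunOnFinite.symm α)) 1)

lemma linProd_eq_sum {n : ℕ} (m : ℕ) (c : Fin n → ℂ) :
    linProd m c = ∑ α ∈ Fintype.piFinset fun _ : Fin n => Finset.range (m + 1),
      (∏ i, (m.choose (α i) : ℂ) * (-c i) ^ α i) •
        monomial (Finsupp.equivFunOnFinite.symm α) 1 := by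
  have h : ∀ i, (1 - C (c i) * X i : MvPolynomial (Fin n) ℂ) ^ m =
      ∑ k ∈ Finset.range (m + 1), C ((m.choose k : ℂ) * (-c i) ^ k) * X i ^ k := by
    intro i
    rw [show (1 - C (c i) * X i : MvPolynomial (Fin n) ℂ) = C (-c i) * X i + 1 by
      rw [map_neg]; ring, add_pow]
    refine Finset.sum_congr rfl fun k _ => ?_
    rw [mul_pow, one_pow, map_mul, map_pow, map_natCast]
    ring
  rw [linProd]
  simp only [h]
  rw [Finset.prod_univ_sum (fun _ => Finset.range (m + 1)) (fun i k =>
    C ((m.choose k : ℂ) * (-c i) ^ k) * X i ^ k)]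
  refine Finset.sum_congr rfl fun α _ => ?_
  rw [Finset.prod_mul_distrib, smul_eq_C_mul, map_prod, monomial_eq, C_1, one_mul,
    Finsupp.prod_fintype _ _ fun i => pow_zero _]
  rfl

lemma eval_symbolApprox {n : ℕ} (T : MvPolynomial (Fin n) ℂ →ₗ[ℂ] MvPolynomial (Fin n) ℂ)
    (m : ℕ) (zw : Fin n ⊕ Fin n → ℂ) :
    eval zw (symbolApprox T m) =
      eval (zw ∘ Sum.inl) (T (linProd m fun i => zw (Sum.inr i) / m)) := by
  rw [linProd_eq_sum, map_sum, map_sum, symbolApprox, map_sum]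
  refine Finset.sum_congr rfl fun α _ => ?_
  rw [smul_eval, map_smul, smul_eval, map_mul, eval_rename, eval_monomial,
    Finsupp.prod_mapDomain_index_inj Sum.inr_injective, Finsupp.prod_fintype _ _ fun i => pow_zero _,
    one_mul]
  simp only [Finsupp.equivFunOnFinite_symm_apply_apply]
  rw [mul_comm (eval _ _), ← mul_assoc, ← Finset.prod_mul_distrib]
  congr 1
  refine Finset.prod_congr rfl fun i _ => ?_
  rw [mul_assoc, ← mul_pow]
  congr 2
  ring

lemma coeff_rename_inl_mul_monomial {κ ι : Type*} (p : MvPolynomial κ ℂ) (α : ι →₀ ℕ)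
    (γ : κ ⊕ ι →₀ ℕ) [Decidable ((Finsupp.sumFinsuppEquivProdFinsupp γ).2 = α)] :
    coeff γ (rename Sum.inl p * monomial (Finsupp.mapDomain Sum.inr α) 1) =
      if (Finsupp.sumFinsuppEquivProdFinsupp γ).2 = α then
        coeff (Finsupp.sumFinsuppEquivProdFinsupp γ).1 p else 0 := by
  induction p using MvPolynomial.induction_on' with
  | monomial β a =>
    classical
    rw [rename_monomial, monomial_mul, mul_one, coeff_monomial, coeff_monomial]
    have h : Finsupp.mapDomain Sum.inl β + Finsupp.mapDomain Sum.inr α =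
        Finsupp.sumFinsuppEquivProdFinsupp.symm (β, α) := by
      ext (i | i)
      · rw [Finsupp.add_apply, Finsupp.mapDomain_apply Sum.inl_injective,
          Finsupp.mapDomain_of_notMem_range _ _ (by simp),
          Finsupp.sumFinsuppEquivProdFinsupp_symm_inl, add_zero]
      · rw [Finsupp.add_apply, Finsupp.mapDomain_apply Sum.inr_injective,
          Finsupp.mapDomain_of_notMem_range _ _ (by simp),
          Finsupp.sumFinsuppEquivProdFinsupp_symm_inr, zero_add]
    have hiff : Finsupp.sumFinsuppEquivProdFinsupp.symm (β, α) = γ ↔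
        (Finsupp.sumFinsuppEquivProdFinsupp γ).2 = α ∧
          β = (Finsupp.sumFinsuppEquivProdFinsupp γ).1 := by
      rw [Equiv.symm_apply_eq, Prod.ext_iff, eq_comm (a := α), and_comm]
    simp only [h, hiff, ite_and]
  | add p q hp hq =>
    rw [map_add, add_mul, coeff_add, hp, hq, coeff_add]
    split_ifs <;> simp

lemma coeff_symbolApprox {n : ℕ} (T : MvPolynomial (Fin n) ℂ →ₗ[ℂ] MvPolynomial (Fin n) ℂ)
    (m : ℕ) (γ : Fin n ⊕ Fin n →₀ ℕ) :
    coeff γ (symbolApprox T m) =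
      (∏ i, (m.choose (γ (Sum.inr i)) : ℂ) * (1 / m) ^ γ (Sum.inr i) *
        (γ (Sum.inr i)).factorial) * symbolCoeff T γ := by
  classical
  rw [symbolApprox, coeff_sum]
  simp only [coeff_smul, coeff_rename_inl_mul_monomial, smul_eq_mul, mul_ite, mul_zero]
  have hcond : ∀ α : Fin n → ℕ, (Finsupp.sumFinsuppEquivProdFinsupp γ).2 =
      Finsupp.equivFunOnFinite.symm α ↔ (fun i => γ (Sum.inr i)) = α := by
    intro α
    rw [Equiv.eq_symm_apply]
    rfl
  simp only [hcond]
  rw [Finset.sum_ite_eq, symbolCoeff, ← mul_assoc, ← Finset.prod_mul_distrib]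
  have hα : (Finsupp.equivFunOnFinite.symm fun i => γ (Sum.inr i)) =
      (Finsupp.sumFinsuppEquivProdFinsupp γ).2 := ((hcond _).mpr rfl).symm
  rw [hα]
  split_ifs with h
  · congr 1
    refine Finset.prod_congr rfl fun i _ => ?_
    have := Nat.cast_ne_zero (R := ℂ).mpr (γ (Sum.inr i)).factorial_ne_zero
    rw [neg_div, neg_pow]
    field_simp
  · rw [Fintype.mem_piFinset] at h
    push Not at h
    obtain ⟨i, hi⟩ := h
    rw [Finset.mem_range, Nat.lt_succ_iff, not_le] at hi
    rw [Finset.prod_eq_zero (Finset.mem_univ i), zero_mul]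
    rw [Nat.choose_eq_zero_of_lt hi]
    simp

lemma tendsto_coeff_symbolApprox {n : ℕ}
    (T : MvPolynomial (Fin n) ℂ →ₗ[ℂ] MvPolynomial (Fin n) ℂ) (γ : Fin n ⊕ Fin n →₀ ℕ) :
    Filter.Tendsto (fun m => coeff γ (symbolApprox T m)) Filter.atTop
      (nhds (symbolCoeff T γ)) := by
  simp only [coeff_symbolApprox]
  rw [show nhds (symbolCoeff T γ) = nhds ((∏ _i : Fin n, (1 : ℂ)) * symbolCoeff T γ) by simp]
  refine Filter.Tendsto.mul_const _ (tendsto_finsetProd _ fun i _ => ?_)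
  set k := γ (Sum.inr i)
  have h1 : Filter.Tendsto (fun m : ℕ => (m : ℝ) * (1 / (m : ℝ))) Filter.atTop (nhds 1) := by
    refine tendsto_const_nhds.congr' ?_
    filter_upwards [Filter.eventually_ge_atTop 1] with m hm
    field
  have h2 := (ProbabilityTheory.tendsto_choose_mul_pow_atTop k h1).mul_const (k.factorial : ℝ)
  have h3 := (Complex.continuous_ofReal.tendsto _).comp h2
  have hk : (k.factorial : ℝ) ≠ 0 := by positivity
  rw [one_pow, one_div_mul_cancel hk, Complex.ofReal_one] at h3
  refine h3.congr fun m => ?_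
  simp

lemma hasSum_transSymbolTerm {n : ℕ} (T : MvPolynomial (Fin n) ℂ →ₗ[ℂ] MvPolynomial (Fin n) ℂ)
    (zw : Fin n ⊕ Fin n → ℂ) (hs : Summable fun γ => symbolCoeff T γ * ∏ i, zw i ^ γ i) :
    HasSum (fun α => transSymbolTerm T α zw) (∑' γ, symbolCoeff T γ * ∏ i, zw i ^ γ i) := by
  have h1 := hs.hasSum
  rw [← ((Equiv.prodComm _ _).trans
    (Finsupp.sumFinsuppEquivProdFinsupp (α := Fin n) (β := Fin n) (γ := ℕ)).symm).hasSum_iff] at h1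
  refine h1.prod_fiberwise fun α => ?_
  have h2 := ((hasSum_coeff_eval (T (monomial α 1)) (zw ∘ Sum.inl)).mul_left
    (∏ i, (-1) ^ α i / ((α i).factorial : ℂ))).mul_right (∏ i, zw (Sum.inr i) ^ α i)
  have h3 : transSymbolTerm T α zw = (∏ i, (-1) ^ α i / ((α i).factorial : ℂ)) *
      eval (zw ∘ Sum.inl) (T (monomial α 1)) * ∏ i, zw (Sum.inr i) ^ α i := by
    rw [transSymbolTerm, Finsupp.sum_fintype _ _ fun _ => rfl,
      Finsupp.prod_fintype _ _ fun _ => by simp, ← Finset.prod_pow_eq_pow_sum,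
      Finset.prod_div_distrib]
  rw [h3]
  refine h2.congr_fun fun β => ?_
  simp only [Function.comp_apply, Equiv.trans_apply, Equiv.prodComm_apply, Prod.swap_prod_mk,
    symbolCoeff, Equiv.apply_symm_apply, Fintype.prod_sum_type,
    Finsupp.sumFinsuppEquivProdFinsupp_symm_inl, Finsupp.sumFinsuppEquivProdFinsupp_symm_inr]
  ring

lemma exists_eq_smul_of_forall_isStable_or_eq_zero {σ : Type*}
    (T : MvPolynomial σ ℂ →ₗ[ℂ] MvPolynomial σ ℂ) (h : ∀ f, IsStable (T f) ∨ T f = 0) :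
    ∃ (a : MvPolynomial σ ℂ →ₗ[ℂ] ℂ) (P : MvPolynomial σ ℂ),
      IsStable P ∧ ∀ f : MvPolynomial σ ℂ, T f = a f • P := by
  by_cases hT : ∀ f, T f = 0
  · exact ⟨0, 1, fun z _ => by simp, fun f => by simp [hT f]⟩
  push Not at hT
  obtain ⟨f₁, hf₁⟩ := hT
  have hP := (h f₁).resolve_right hf₁
  set z₀ : σ → ℂ := fun _ => Complex.I
  have hz₀ : ∀ i, 0 < (z₀ i).im := fun i => by simp [z₀]
  refine ⟨(eval z₀ (T f₁))⁻¹ • (aeval z₀).toLinearMap ∘ₗ T, T f₁, hP, fun f => ?_⟩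
  have ha : ((eval z₀ (T f₁))⁻¹ • (aeval z₀).toLinearMap ∘ₗ T : MvPolynomial σ ℂ →ₗ[ℂ] ℂ) f =
      (eval z₀ (T f₁))⁻¹ * eval z₀ (T f) := by
    simp [aeval_eq_eval]
  rw [ha, ← sub_eq_zero, ← map_smul, ← map_sub]
  refine (h _).resolve_left fun hs => hs z₀ hz₀ ?_
  rw [map_sub, map_smul, map_sub, smul_eval, mul_right_comm, inv_mul_cancel₀ (hP z₀ hz₀), one_mul,
    sub_self]

/-- The symbol of a stability preserver that is not of rank at most one with stable image is the
limit of the polynomials `symbolApprox`. -/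
lemma exists_transSymbol_of_preserves {n : ℕ}
    (T : MvPolynomial (Fin n) ℂ →ₗ[ℂ] MvPolynomial (Fin n) ℂ)
    (hT : ∀ f, IsStable f → IsStable (T f) ∨ T f = 0) (f₀ : MvPolynomial (Fin n) ℂ)
    (hf₀ : ¬ IsStable (T f₀)) (hf₀' : T f₀ ≠ 0) :
    ∃ F : (Fin n ⊕ Fin n → ℂ) → ℂ,
      (∀ zw : Fin n ⊕ Fin n → ℂ,
        HasSum (fun α : Fin n →₀ ℕ => transSymbolTerm T α zw) (F zw)) ∧
      ∃ g : ℕ → MvPolynomial (Fin n ⊕ Fin n) ℂ,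
        (∀ k, IsStable (g k)) ∧
        ∀ K : Set (Fin n ⊕ Fin n → ℂ), IsCompact K →
          TendstoUniformlyOn (fun k zw => MvPolynomial.eval zw (g k)) F Filter.atTop K := by
  set m₀ := f₀.totalDegree + 1
  set g : ℕ → MvPolynomial (Fin n ⊕ Fin n) ℂ := fun k => symbolApprox T (k + m₀) with hg
  have hgs : ∀ k, IsStable (g k) := by
    intro k zw hzw
    rw [hg, eval_symbolApprox]
    refine isStable_map_linProd T hT f₀ hf₀ hf₀' (k + m₀)
      (fun i => (degreeOf_le_totalDegree f₀ i).trans (by omega)) _ (fun i => ?_) _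
      fun i => hzw (Sum.inl i)
    rw [Complex.div_natCast_im]
    have : 0 < k + m₀ := by omega
    exact div_pos (hzw (Sum.inr i)) (by exact_mod_cast this)
  have hc : ∀ γ, Filter.Tendsto (fun k => coeff γ (g k)) Filter.atTop (nhds (symbolCoeff T γ)) :=
    fun γ => (tendsto_coeff_symbolApprox T γ).comp (Filter.tendsto_add_atTop_nat m₀)
  have hzero : ∀ γ, symbolCoeff T γ = 0 → ∀ k, coeff γ (g k) = 0 := fun γ hγ k => by
    rw [hg, coeff_symbolApprox, hγ, mul_zero]
  have hne : ∃ γ, symbolCoeff T γ ≠ 0 := by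
    by_contra! h
    have h0 : g 0 = 0 := MvPolynomial.ext _ _ fun γ => by rw [hzero γ (h γ), coeff_zero]
    exact hgs 0 (fun _ => Complex.I) (fun _ => by simp) (by rw [h0, map_zero])
  obtain ⟨h1, h2⟩ := summable_and_tendstoUniformlyOn_of_coeff g (symbolCoeff T) hc
    fun L hL => exists_norm_coeff_le_of_tendsto g hgs (symbolCoeff T) hc hzero hne L hL
  exact ⟨_, fun zw => hasSum_transSymbolTerm T zw (h1 zw), g, hgs, h2⟩

/-- Theorem 3 (Borcea–Brändén): a linear operator
`T : ℂ[z₁,…,zₙ] → ℂ[z₁,…,zₙ]` preserves stability if and only if either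
(a) `T` has range of dimension at most one, being of the form `T(f) = α(f)·P`
with `P` stable, or (b) the transcendental symbol
`Ḡ_T(z,w) = ∑_α (-1)^{|α|} T(z^α) w^α/α!` converges on all of `ℂ^{2n}` to an
entire function which is a limit, uniformly on compact subsets of `ℂ^{2n}`,
of stable polynomials in `2n` variables. -/
theorem stability_preserver_transcendental_complex (n : ℕ)
    (T : MvPolynomial (Fin n) ℂ →ₗ[ℂ] MvPolynomial (Fin n) ℂ) :
    (∀ f : MvPolynomial (Fin n) ℂ, IsStable f → IsStable (T f) ∨ T f = 0) ↔
      ((∃ (a : MvPolynomial (Fin n) ℂ →ₗ[ℂ] ℂ) (P : MvPolynomial (Fin n) ℂ),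
          IsStable P ∧ ∀ f : MvPolynomial (Fin n) ℂ, T f = a f • P) ∨
        (∃ F : (Fin n ⊕ Fin n → ℂ) → ℂ,
          (∀ zw : Fin n ⊕ Fin n → ℂ,
            HasSum (fun α : Fin n →₀ ℕ => transSymbolTerm T α zw) (F zw)) ∧
          ∃ g : ℕ → MvPolynomial (Fin n ⊕ Fin n) ℂ,
            (∀ k, IsStable (g k)) ∧
            ∀ K : Set (Fin n ⊕ Fin n → ℂ), IsCompact K →
              TendstoUniformlyOn (fun k zw => MvPolynomial.eval zw (g k)) F
                Filter.atTop K)) := by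
  constructor
  · intro hT
    by_cases h : ∀ f, IsStable (T f) ∨ T f = 0
    · exact Or.inl (exists_eq_smul_of_forall_isStable_or_eq_zero T h)
    · push Not at h
      obtain ⟨f₀, hf₀, hf₀'⟩ := h
      exact Or.inr (exists_transSymbol_of_preserves T hT f₀ hf₀ hf₀')
  · rintro (⟨a, P, hP, hT⟩ | ⟨F, hF, g, hg, hlim⟩) f hf
    · rw [hT f]
      by_cases ha : a f = 0
      · exact Or.inr (by rw [ha, zero_smul])
      · refine Or.inl fun z hz => ?_
        rw [smul_eval]
        exact mul_ne_zero ha (hP z hz)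
    · exact isStable_or_eq_zero_of_transSymbol T F hF g hg hlim f hf
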